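/- arXiv:1206.1435 — 7 statements merged into one kernel-verified Lean document; each statement's English description precedes it below -/
import Mathlib

section
/- Let φ : ℝ → ℂ be a continuous function with compact support. Then the limit as ε → 0⁺ of (1/(2πi)) ∫_ℝ ( φ(x)/(x − iε) − φ(x)/(x + iε) ) dx exists and equals φ(0). -/
open MeasureTheory Filter Complex

/-- The Dirac delta at `0` as a hyperfunction boundary value: for a continuous compactly
supported `φ : ℝ → ℂ`, the limit as `ε → 0⁺` of
`(1/(2πi)) ∫ (φ(x)/(x − iε) − φ(x)/(x + iε)) dx` exists and equals `φ 0`. -/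
theorem dirac_boundary_value (φ : ℝ → ℂ) (hφ : Continuous φ) (hsupp : HasCompactSupport φ) :
    Tendsto
      (fun ε : ℝ =>
        (1 / (2 * Real.pi * Complex.I)) *
          ∫ x : ℝ, (φ x / ((x : ℂ) - ε * Complex.I) - φ x / ((x : ℂ) + ε * Complex.I)))
      (nhdsWithin 0 (Set.Ioi 0)) (nhds (φ 0)) := by
  have hlim : Tendsto (fun x : ℝ => ‖x‖ ^ Module.finrank ℝ ℝ * (Real.pi⁻¹ * (1 + x ^ 2)⁻¹))
      (Bornology.cobounded ℝ) (nhds 0) := by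
    have h1 : Tendsto (fun x : ℝ => Real.pi⁻¹ * ‖x‖⁻¹) (Bornology.cobounded ℝ) (nhds 0) := by
      simpa using ((tendsto_norm_cobounded_atTop (E := ℝ)).inv_tendsto_atTop).const_mul Real.pi⁻¹
    refine squeeze_zero (fun x => by positivity) (fun x => ?_) h1
    rw [Module.finrank_self, pow_one, mul_left_comm]
    refine mul_le_mul_of_nonneg_left ?_ (by positivity)
    rcases eq_or_ne x 0 with rfl | hx
    · simp
    · have hx' : 0 < ‖x‖ := norm_pos_iff.2 hx
      have h2 : ‖x‖ * ‖x‖ = x ^ 2 := by rw [Real.norm_eq_abs, abs_mul_abs_self, sq]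
      rw [← div_eq_mul_inv, ← one_div, div_le_div_iff₀ (by positivity) hx', h2]
      linarith
  have key := tendsto_integral_comp_smul_smul_of_integrable (μ := (volume : Measure ℝ))
    (φ := fun x : ℝ => Real.pi⁻¹ * (1 + x ^ 2)⁻¹) (fun x => by positivity)
    (by rw [integral_const_mul, integral_univ_inv_one_add_sq,
          inv_mul_cancel₀ Real.pi_ne_zero])
    hlim (hφ.integrable_of_hasCompactSupport hsupp) hφ.continuousAt
  refine (key.comp tendsto_inv_nhdsGT_zero).congr' ?_
  filter_upwards [self_mem_nhdsWithin] with ε hε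
  have hε : 0 < ε := hε
  simp only [Function.comp]
  rw [← integral_const_mul]
  refine integral_congr_ae (Eventually.of_forall fun x => ?_)
  simp only [Module.finrank_self, pow_one, smul_eq_mul, Complex.real_smul]
  have hm : (x : ℂ) - ε * Complex.I ≠ 0 := fun h => hε.ne' (by simpa using congrArg Complex.im h)
  have hp : (x : ℂ) + ε * Complex.I ≠ 0 := fun h => hε.ne' (by simpa using congrArg Complex.im h)
  have hmp : ((x : ℂ) - ε * Complex.I) * (x + ε * Complex.I) = x ^ 2 + ε ^ 2 := by
    linear_combination (-(ε : ℂ) ^ 2) * Complex.I_sq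
  have hq : (x : ℂ) ^ 2 + ε ^ 2 ≠ 0 := hmp ▸ mul_ne_zero hm hp
  have he : (ε : ℂ) ≠ 0 := by exact_mod_cast hε.ne'
  have hpi : (Real.pi : ℂ) ≠ 0 := by exact_mod_cast Real.pi_ne_zero
  have hk : (1 : ℂ) + ((ε : ℂ)⁻¹ * x) ^ 2 = (x ^ 2 + ε ^ 2) / ε ^ 2 := by
    field_simp
    ring
  rw [div_sub_div _ _ hm hp, hmp]
  push_cast
  rw [hk]
  field_simp
  ring
end

section
/- Let X₁ ⊆ X₂ be open subsets of ℂ with X₁ ∩ ℝ = X₂ ∩ ℝ = M (where ℝ is regarded as the real axis in ℂ). Then the restriction map O(X₂ ∖ M) → O(X₁ ∖ M) induces a linear isomorphism of quotient vector spaces O(X₂ ∖ M)/O(X₂) ≅ O(X₁ ∖ M)/O(X₁), where for an open set X ⊇ X ∖ M the space O(X) is viewed as a subspace of O(X ∖ M) via restriction. In particular the space of hyperfunctions B(M) = O(X ∖ M)/O(X) depends only on M and not on the choice of the open set X with X ∩ ℝ = M. -/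
open Set

/-- The real axis inside `ℂ`. -/
def realAxis : Set ℂ := {z : ℂ | z.im = 0}

/-- The space `O(S)` of holomorphic functions on `S`, as a submodule of `ℂ → ℂ`
(a function represents its restriction to `S`). -/
noncomputable def holo (S : Set ℂ) : Submodule ℂ (ℂ → ℂ) where
  carrier := {f | DifferentiableOn ℂ f S}
  add_mem' hf hg := hf.add hg
  zero_mem' := differentiableOn_const 0
  smul_mem' c f hf := hf.const_smul c

/-- The subspace of `O(X ∖ M)` consisting of (restrictions of) functions holomorphic on all
of `X`; the quotient by it is the space of hyperfunctions `B(M) = O(X ∖ M)/O(X)`. -/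
noncomputable def holoExt (X M : Set ℂ) : Submodule ℂ ↥(holo (X \ M)) where
  carrier := {f | ∃ g : ℂ → ℂ, DifferentiableOn ℂ g X ∧ EqOn (f : ℂ → ℂ) g (X \ M)}
  add_mem' := by
    rintro f g ⟨F, hF, hFf⟩ ⟨G, hG, hGg⟩
    exact ⟨F + G, hF.add hG, fun z hz => by
      simp only [Submodule.coe_add, Pi.add_apply, hFf hz, hGg hz]⟩
  zero_mem' := ⟨0, differentiableOn_const 0, fun z _ => rfl⟩
  smul_mem' := by
    rintro c f ⟨F, hF, hFf⟩
    exact ⟨c • F, hF.const_smul c, fun z hz => by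
      simp only [SetLike.val_smul, Pi.smul_apply, hFf hz]⟩

/-- The space of hyperfunctions `B(M) = O(X ∖ M)/O(X)` attached to an open set `X ⊆ ℂ`
with `X ∩ ℝ = M`. -/
abbrev Hyperfunctions (X M : Set ℂ) := ↥(holo (X \ M)) ⧸ holoExt X M

open MeasureTheory Filter Topology Complex in
theorem hf_integrableOn_inv (z : ℂ) (R : ℝ) :
    IntegrableOn (fun w : ℂ => ‖z - w‖⁻¹) (Metric.ball z R) := by
  have h0 : IntegrableOn (fun w : ℂ => ‖w‖⁻¹) (Metric.ball 0 R) := by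
    have := (integrableOn_fun_norm_addHaar (volume : Measure ℂ) (f := fun y : ℝ => y⁻¹) (r := R)).2
    refine this ?_
    refine IntegrableOn.congr_fun (f := fun _ => (1:ℝ)) ?_ ?_ measurableSet_Ioo
    · exact integrableOn_const (by simp)
    · intro y hy
      have : y ≠ 0 := hy.1.ne'
      simp [this]
  have h1 := (MeasurePreserving.integrableOn_comp_preimage
    (Measure.measurePreserving_sub_left (volume : Measure ℂ) z)
    (Homeomorph.subLeft z).measurableEmbedding (f := fun w : ℂ => ‖w‖⁻¹) (s := Metric.ball 0 R)).2 h0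
  have hset : Metric.ball z R = (fun t => z - t) ⁻¹' Metric.ball 0 R := by
    ext w
    simp [dist_eq_norm, norm_sub_rev]
  rw [hset]
  exact h1

open MeasureTheory Filter Topology Complex in
theorem hf_integrable_kernel (F : ℂ → ℂ) (hF : AEStronglyMeasurable F volume) (C R : ℝ)
    (hC : ∀ w, ‖F w‖ ≤ C) (hR : ∀ w, R ≤ ‖w‖ → F w = 0) (z : ℂ) :
    Integrable (fun w => F w / (z - w)) := by
  have h1 : Integrable (indicator (Metric.ball z (R + ‖z‖)) (fun w : ℂ => C * ‖z - w‖⁻¹)) :=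
    (integrable_indicator_iff measurableSet_ball).2 ((hf_integrableOn_inv z _).const_mul C)
  refine h1.mono' ?_ ?_
  · simp_rw [div_eq_mul_inv]
    exact hF.mul (by fun_prop : Measurable fun w : ℂ => (z - w)⁻¹).aestronglyMeasurable
  · refine Eventually.of_forall fun w => ?_
    by_cases hw : w ∈ Metric.ball z (R + ‖z‖)
    · rw [indicator_of_mem hw, norm_div, div_eq_mul_inv]
      gcongr
      exact hC w
    · have : F w = 0 := by
        apply hR
        simp only [Metric.mem_ball, dist_eq_norm, not_lt] at hw
        have := norm_sub_le w z
        linarith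
      rw [indicator_of_notMem hw]
      simp [this]

/-- Twice the Wirtinger derivative. -/
noncomputable def hf_dbar (φ : ℂ → ℂ) (w : ℂ) : ℂ :=
  fderiv ℝ φ w 1 + Complex.I * fderiv ℝ φ w Complex.I

open MeasureTheory Filter Topology Complex in
theorem hf_pompeiu (φ : ℂ → ℂ) (hφ : ContDiff ℝ 1 φ) (hc : HasCompactSupport φ) (z : ℂ) :
    ∫ w, hf_dbar φ w / (z - w) = 2 * Real.pi * φ z := by
  have hd : Differentiable ℝ φ := hφ.differentiable (by simp)
  have hdc : Continuous (fderiv ℝ φ) := hφ.continuous_fderiv (by simp)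
  obtain ⟨R0, hR0⟩ := hc.isCompact.isBounded.subset_ball z
  set R := max R0 1 with hRdef
  have hRpos : 0 < R := lt_max_of_lt_right one_pos
  have hzero : ∀ w, R ≤ ‖w - z‖ → φ w = 0 ∧ fderiv ℝ φ w = 0 := by
    intro w hw
    have : w ∉ tsupport φ := fun h => by
      have := hR0 h
      rw [Metric.mem_ball, dist_eq_norm] at this
      exact absurd ((le_max_left R0 1).trans hw) (not_le.2 this)
    exact ⟨image_eq_zero_of_notMem_tsupport this,
      image_eq_zero_of_notMem_tsupport fun h => this (tsupport_fderiv_subset ℝ h)⟩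
  set E : ℝ → ℂ := fun t => cexp (t * I) with hE
  have hEc : Continuous E := by fun_prop
  have hEn : ∀ t, ‖E t‖ = 1 := fun t => norm_exp_ofReal_mul_I t
  have hEne : ∀ t, E t ≠ 0 := fun t => exp_ne_zero _
  set A : ℝ × ℝ → ℂ := fun p => fderiv ℝ φ (z + p.1 * E p.2) (E p.2) with hA
  set B : ℝ × ℝ → ℂ := fun p => I * fderiv ℝ φ (z + p.1 * E p.2) (I * E p.2) with hB
  have hAc : Continuous A := by
    refine Continuous.clm_apply (hdc.comp (by fun_prop)) (by fun_prop)
  have hBc : Continuous B := by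
    refine continuous_const.mul (Continuous.clm_apply (hdc.comp (by fun_prop)) (by fun_prop))
  have key : ∀ p : ℝ × ℝ, 0 < p.1 → p.1 • (hf_dbar φ (z + p.1 * E p.2) / (-(p.1 * E p.2)))
      = -(A p + B p) := by
    intro p hp
    have hp' : (p.1 : ℂ) ≠ 0 := by exact_mod_cast hp.ne'
    set L := fderiv ℝ φ (z + p.1 * E p.2) with hL
    have e1 : E p.2 = (Real.cos p.2) • (1 : ℂ) + (Real.sin p.2) • I := by
      simp [hE, exp_mul_I]
    have e2 : I * E p.2 = (- Real.sin p.2) • (1 : ℂ) + (Real.cos p.2) • I := by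
      rw [e1]; simp only [real_smul, ofReal_neg]; linear_combination ((Real.sin p.2 : ℝ) : ℂ) * I_sq
    have hA' : A p = Real.cos p.2 * L 1 + Real.sin p.2 * L I := by
      change L (E p.2) = _
      rw [e1, map_add, map_smul, map_smul]; simp
    have hB' : B p = I * (-Real.sin p.2 * L 1 + Real.cos p.2 * L I) := by
      change I * L (I * E p.2) = _
      rw [e2, map_add, map_smul, map_smul]; simp
    have h1 : (E p.2) * (Real.cos p.2 - Real.sin p.2 * I) = 1 := by
      rw [e1]; simp only [real_smul]
      have := Real.cos_sq_add_sin_sq p.2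
      have h : ((Real.cos p.2 : ℂ))^2 + (Real.sin p.2 : ℂ)^2 = 1 := by exact_mod_cast this
      linear_combination h - (Real.sin p.2 : ℂ)^2 * I_sq
    have h2 : (E p.2)⁻¹ = Real.cos p.2 - Real.sin p.2 * I := inv_eq_of_mul_eq_one_right h1
    rw [hA', hB', hf_dbar, ← hL, real_smul, div_neg, mul_neg, mul_div_assoc', mul_div_mul_left _ _ hp',
      div_eq_mul_inv, h2]
    linear_combination (Real.sin p.2 : ℂ) * L I * I_sq
  have step1 : ∫ w, hf_dbar φ w / (z - w) =
      ∫ p in Ioi (0 : ℝ) ×ˢ Ioo (-Real.pi) Real.pi, -(A p + B p) := by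
    rw [← integral_add_left_eq_self (fun w => hf_dbar φ w / (z - w)) z,
      ← Complex.integral_comp_polarCoord_symm]
    refine setIntegral_congr_fun (measurableSet_Ioi.prod measurableSet_Ioo) ?_
    intro p hp
    change _ = -(A p + B p)
    rw [← key p hp.1]
    have : Complex.polarCoord.symm p = p.1 * E p.2 := by
      rw [Complex.polarCoord_symm_apply, hE]; simp [exp_mul_I]
    simp only [this, sub_add_cancel_left]
  have hABzero : ∀ p : ℝ × ℝ, R ≤ p.1 → A p = 0 ∧ B p = 0 := by
    intro p hp
    have : fderiv ℝ φ (z + p.1 * E p.2) = 0 := by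
      refine (hzero _ ?_).2
      simp only [add_sub_cancel_left, norm_mul, hEn, mul_one, norm_real, Real.norm_eq_abs]
      exact hp.trans (le_abs_self _)
    simp [hA, hB, this]
  have step2 : ∫ p in Ioi (0 : ℝ) ×ˢ Ioo (-Real.pi) Real.pi, -(A p + B p) =
      ∫ p in Ioc (0 : ℝ) R ×ˢ Ioo (-Real.pi) Real.pi, -(A p + B p) := by
    refine setIntegral_eq_of_subset_of_forall_sdiff_eq_zero
      (measurableSet_Ioi.prod measurableSet_Ioo) (prod_mono Ioc_subset_Ioi_self subset_rfl) ?_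
    rintro p ⟨⟨h1, h2⟩, h3⟩
    have : R ≤ p.1 := by
      by_contra h
      exact h3 ⟨⟨h1, (not_le.1 h).le⟩, h2⟩
    simp [hABzero p this]
  have hint : ∀ G : ℝ × ℝ → ℂ, Continuous G →
      IntegrableOn G (Ioc (0 : ℝ) R ×ˢ Ioo (-Real.pi) Real.pi) (volume.prod volume) := fun G hG =>
    (hG.continuousOn.integrableOn_compact (μ := volume) (isCompact_Icc.prod isCompact_Icc)).mono_set
      (prod_mono Ioc_subset_Icc_self Ioo_subset_Icc_self)
  have hIA : ∫ p in Ioc (0 : ℝ) R ×ˢ Ioo (-Real.pi) Real.pi, A p = -(2 * Real.pi * φ z) := by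
    rw [Measure.volume_eq_prod, ← setIntegral_prod_swap, setIntegral_prod]
    · have : ∀ t, ∫ r in Ioc 0 R, A (Prod.swap (t, r)) = - φ z := by
        intro t
        rw [← intervalIntegral.integral_of_le hRpos.le]
        have hder : ∀ r ∈ uIcc 0 R, HasDerivAt (fun r : ℝ => φ (z + r * E t))
            (A (Prod.swap (t, r))) r := by
          intro r _
          have h1 : HasDerivAt (fun r : ℝ => z + r * E t) (E t) r := by
            simpa using ((hasDerivAt_id r).ofReal_comp.mul_const (E t)).const_add z
          exact (hd (z + r * E t)).hasFDerivAt.comp_hasDerivAt r h1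
        rw [intervalIntegral.integral_eq_sub_of_hasDerivAt hder
          ((hAc.comp (by fun_prop)).intervalIntegrable _ _)]
        have := (hzero (z + R * E t) (by simp [hEn, abs_of_pos hRpos])).1
        simp [this]
      simp_rw [this]
      rw [setIntegral_const, Real.volume_real_Ioo_of_le (by linarith [Real.pi_pos]), real_smul]
      push_cast
      ring
    · have := (hint A hAc).swap
      exact this
  have hIB : ∫ p in Ioc (0 : ℝ) R ×ˢ Ioo (-Real.pi) Real.pi, B p = 0 := by
    rw [Measure.volume_eq_prod, setIntegral_prod _ (hint B hBc)]
    refine (setIntegral_congr_fun measurableSet_Ioc (g := fun _ => 0) ?_).trans (by simp)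
    intro r hr
    have hr' : (r : ℂ) ≠ 0 := by exact_mod_cast hr.1.ne'
    change ∫ t in Ioo (-Real.pi) Real.pi, B (r, t) = 0
    rw [← integral_Ioc_eq_integral_Ioo, ← intervalIntegral.integral_of_le (by linarith [Real.pi_pos])]
    have hder : ∀ t ∈ uIcc (-Real.pi) Real.pi, HasDerivAt (fun t : ℝ => I / r * φ (z + r * E t))
            (B (r, t)) t := by
      intro t _
      have h0 : HasDerivAt E (I * E t) t := by
        have := ((hasDerivAt_id t).ofReal_comp.mul_const I).cexp
        simpa [hE, mul_comm] using this
      have h1 : HasDerivAt (fun t : ℝ => z + r * E t) (r • (I * E t)) t := by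
        simpa using (h0.const_mul (r : ℂ)).const_add z
      have h2 := ((hd (z + r * E t)).hasFDerivAt.comp_hasDerivAt t h1).const_mul (I / r)
      have h3 : I / r * (fderiv ℝ φ (z + r * E t)) (r • (I * E t)) = B (r, t) := by
        rw [map_smul, real_smul]
        simp only [hB]
        field_simp
      rw [h3] at h2
      exact h2
    rw [intervalIntegral.integral_eq_sub_of_hasDerivAt hder
          ((hBc.comp (by fun_prop)).intervalIntegrable _ _)]
    have : E Real.pi = E (-Real.pi) := by
      simp [hE, exp_neg]
    rw [this, sub_self]
  rw [step1, step2, integral_neg]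
  have := integral_add (hint A hAc) (hint B hBc)
  rw [← Measure.volume_eq_prod] at this
  rw [this, hIA, hIB]
  simp

open MeasureTheory Filter Topology Complex in
theorem hf_holo (F : ℂ → ℂ) (hF : Integrable F) (z₀ : ℂ) (hz : ∀ᶠ w in 𝓝 z₀, F w = 0) :
    DifferentiableAt ℂ (fun z => ∫ w, F w / (z - w)) z₀ := by
  obtain ⟨r, hr, hzr⟩ := Metric.eventually_nhds_iff_ball.1 hz
  have hfar : ∀ w, F w ≠ 0 → ∀ x ∈ Metric.ball z₀ (r / 2), r / 2 ≤ ‖x - w‖ := by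
    intro w hw x hx
    have h1 : w ∉ Metric.ball z₀ r := fun h => hw (hzr w h)
    rw [Metric.mem_ball, not_lt, dist_eq_norm] at h1
    rw [Metric.mem_ball, dist_eq_norm] at hx
    have h2 : ‖w - z₀‖ ≤ ‖x - z₀‖ + ‖x - w‖ := by
      have := norm_sub_le (x - z₀) (x - w)
      simpa using this
    linarith
  have hm : ∀ x : ℂ, AEStronglyMeasurable (fun w => F w / (x - w)) volume := by
    intro x
    simp_rw [div_eq_mul_inv]
    exact hF.1.mul (by fun_prop : Measurable fun w : ℂ => (x - w)⁻¹).aestronglyMeasurable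
  have := hasDerivAt_integral_of_dominated_loc_of_deriv_le (μ := (volume : Measure ℂ))
    (F := fun z w => F w / (z - w)) (F' := fun z w => - F w / (z - w) ^ 2) (x₀ := z₀)
    (bound := fun w => ‖F w‖ * ((r / 2) ^ 2)⁻¹)
    (Metric.ball_mem_nhds z₀ (half_pos hr)) (Eventually.of_forall hm) ?_ ?_ ?_ ?_ ?_
  · exact this.2.differentiableAt
  · refine (hF.norm.mul_const ((r / 2)⁻¹)).mono' (hm z₀) (Eventually.of_forall fun w => ?_)
    by_cases hw : F w = 0
    · simp [hw]
    · rw [norm_div, div_eq_mul_inv]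
      have := hfar w hw z₀ (Metric.mem_ball_self (half_pos hr))
      gcongr
  · simp_rw [div_eq_mul_inv]
    exact hF.1.neg.mul (by fun_prop : Measurable fun w : ℂ => ((z₀ - w) ^ 2)⁻¹).aestronglyMeasurable
  · refine Eventually.of_forall fun w x hx => ?_
    by_cases hw : F w = 0
    · simp [hw]
    · rw [norm_div, div_eq_mul_inv, norm_neg, norm_pow]
      have := hfar w hw x hx
      gcongr
  · exact hF.norm.mul_const _
  · refine Eventually.of_forall fun w x hx => ?_
    by_cases hw : F w = 0
    · simpa [hw] using hasDerivAt_const x (0 : ℂ)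
    · have h1 := hfar w hw x hx
      have h2 : x - w ≠ 0 := by
        intro h
        rw [h, norm_zero] at h1
        linarith
      have h3 := (hasDerivAt_const x (F w)).div ((hasDerivAt_id x).sub_const w) h2
      have h4 : (0 * (id x - w) - F w * 1) / (id x - w) ^ 2 = - F w / (x - w) ^ 2 := by simp
      rw [h4] at h3
      exact h3

/-- Restrictions to `K` of functions holomorphic on `X`. -/
noncomputable def hf_alg (X K : Set ℂ) : Subalgebra ℂ C(K, ℂ) where
  carrier := {g | ∃ P : ℂ → ℂ, DifferentiableOn ℂ P X ∧ ∀ z : K, g z = P z}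
  mul_mem' := by
    rintro a b ⟨P, hP, h1⟩ ⟨Q, hQ, h2⟩
    exact ⟨P * Q, hP.mul hQ, fun z => by simp [h1, h2]⟩
  add_mem' := by
    rintro a b ⟨P, hP, h1⟩ ⟨Q, hQ, h2⟩
    exact ⟨P + Q, hP.add hQ, fun z => by simp [h1, h2]⟩
  algebraMap_mem' := fun c => ⟨fun _ => c, differentiableOn_const c, fun z => rfl⟩

theorem hf_geom {K : Set ℂ} [CompactSpace K] (B : Subalgebra ℂ C(K, ℂ))
    (hB : IsClosed (B : Set C(K, ℂ))) (a : C(K, ℂ)) (ha : a ∈ B) (hn : ‖a‖ < 1) :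
    ∃ y ∈ B, (1 - a) * y = 1 := by
  refine ⟨∑' i : ℕ, a ^ i, ?_, mul_neg_geom_series a hn⟩
  have hs := (summable_geometric_of_norm_lt_one hn).hasSum
  exact hB.mem_of_tendsto hs (Filter.Eventually.of_forall fun s => B.sum_mem fun i _ => B.pow_mem ha i)

/-- The standard exhaustion of an open set. -/
def hf_K (X : Set ℂ) (n : ℕ) : Set ℂ :=
  {z | ‖z‖ ≤ n ∧ ∀ b, b ∉ X → 1 / ((n : ℝ) + 1) ≤ ‖z - b‖}

theorem hf_K_compact (X : Set ℂ) (n : ℕ) : IsCompact (hf_K X n) := by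
  refine Metric.isCompact_of_isClosed_isBounded ?_ ?_
  · have : hf_K X n = {z | ‖z‖ ≤ n} ∩ ⋂ b, ⋂ (_ : b ∉ X), {z | 1 / ((n : ℝ) + 1) ≤ ‖z - b‖} := by
      ext z; simp [hf_K]
    rw [this]
    refine (isClosed_le (by fun_prop) (by fun_prop)).inter
      (isClosed_iInter fun b => isClosed_iInter fun _ => isClosed_le (by fun_prop) (by fun_prop))
  · exact (Metric.isBounded_closedBall (x := (0 : ℂ)) (r := n)).subset fun z hz => by
      simpa using hz.1

theorem hf_K_subset (X : Set ℂ) (n : ℕ) : hf_K X n ⊆ X := by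
  intro z hz
  by_contra h
  have := hz.2 z h
  rw [sub_self, norm_zero] at this
  have : 0 < 1 / ((n : ℝ) + 1) := by positivity
  linarith

theorem hf_K_interior (X : Set ℂ) (n : ℕ) : hf_K X n ⊆ interior (hf_K X (n + 1)) := by
  intro z hz
  rw [mem_interior_iff_mem_nhds, Metric.mem_nhds_iff]
  have hpos : 0 < 1 / ((n : ℝ) + 1) - 1 / ((n : ℝ) + 1 + 1) :=
    sub_pos.2 (one_div_lt_one_div_of_lt (by positivity) (by linarith))
  refine ⟨min 1 (1 / ((n : ℝ) + 1) - 1 / ((n : ℝ) + 1 + 1)), lt_min one_pos hpos, ?_⟩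
  intro y hy
  rw [Metric.mem_ball, dist_eq_norm, lt_min_iff] at hy
  refine ⟨?_, fun b hb => ?_⟩
  · have := norm_sub_norm_le y z
    have := hz.1
    push_cast
    linarith
  · have h1 := hz.2 b hb
    have h2 : ‖z - b‖ ≤ ‖y - b‖ + ‖y - z‖ := by
      have := norm_sub_le (y - b) (y - z)
      simpa using this
    push_cast
    linarith

theorem hf_K_mono (X : Set ℂ) : Monotone (hf_K X) :=
  monotone_nat_of_le_succ fun n => (hf_K_interior X n).trans interior_subset

theorem hf_K_exhaust (X : Set ℂ) (hX : IsOpen X) (z : ℂ) (hz : z ∈ X) : ∃ n, z ∈ hf_K X n := by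
  obtain ⟨r, hr, hrX⟩ := Metric.isOpen_iff.1 hX z hz
  obtain ⟨n1, hn1⟩ := exists_nat_ge ‖z‖
  obtain ⟨n2, hn2⟩ := exists_nat_one_div_lt hr
  refine ⟨max n1 n2, ?_, fun b hb => ?_⟩
  · exact hn1.trans (by exact_mod_cast le_max_left _ _)
  · have h1 : b ∉ Metric.ball z r := fun h => hb (hrX h)
    rw [Metric.mem_ball, not_lt, dist_eq_norm, norm_sub_rev] at h1
    refine le_trans ?_ (hn2.le.trans h1)
    apply one_div_le_one_div_of_le (by positivity)
    have : (n2 : ℝ) ≤ (max n1 n2 : ℕ) := by exact_mod_cast le_max_right _ _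
    linarith

/-- Runge approximation of a single Cauchy kernel. -/
theorem hf_kernel_mem (X : Set ℂ) (n : ℕ) [CompactSpace (hf_K X n)] (w : ℂ) (hw : w ∉ hf_K X n)
    (g : C(hf_K X n, ℂ)) (hg : ∀ z, g z = (z - w)⁻¹) :
    g ∈ (hf_alg X (hf_K X n)).topologicalClosure := by
  set S := hf_alg X (hf_K X n) with hS
  have hcl : IsClosed (S.topologicalClosure : Set C(hf_K X n, ℂ)) :=
    S.isClosed_topologicalClosure
  have hsub : S ≤ S.topologicalClosure := S.le_topologicalClosure
  have hzw : ∀ z : hf_K X n, (z : ℂ) - w ≠ 0 := fun z h => hw (by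
    rw [sub_eq_zero] at h; rw [← h]; exact z.2)
  by_cases h1 : ‖w‖ ≤ n
  · have : ∃ b, b ∉ X ∧ ‖w - b‖ < 1 / ((n : ℝ) + 1) := by
      by_contra h
      push Not at h
      exact hw ⟨h1, h⟩
    obtain ⟨b, hb, hwb⟩ := this
    have hzb : ∀ z : hf_K X n, (z : ℂ) - b ≠ 0 := fun z h => hb (by
      rw [sub_eq_zero] at h; rw [← h]; exact hf_K_subset X n z.2)
    have hpos : 0 < 1 / ((n : ℝ) + 1) := by positivity
    let c : C(hf_K X n, ℂ) := ⟨fun z => ((z : ℂ) - b)⁻¹, by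
      exact Continuous.inv₀ (by fun_prop) hzb⟩
    have hc : c ∈ S := ⟨fun z => (z - b)⁻¹, DifferentiableOn.inv (by fun_prop) (fun z hz h => hb (by
      rw [sub_eq_zero] at h; rw [← h]; exact hz)), fun z => rfl⟩
    obtain ⟨y, hy, hy1⟩ := hf_geom S.topologicalClosure hcl ((w - b) • c)
      (Subalgebra.smul_mem _ (hsub hc) _) (by
        refine lt_of_le_of_lt ((ContinuousMap.norm_le _ (by positivity :
          0 ≤ ‖w - b‖ * (1 / ((n : ℝ) + 1))⁻¹)).2 fun z => ?_) ?_
        · change ‖(w - b) * ((z : ℂ) - b)⁻¹‖ ≤ _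
          rw [norm_mul, norm_inv]
          have := z.2.2 b hb
          gcongr
        · rw [← div_eq_mul_inv, div_lt_one hpos]
          exact hwb)
    have : g = c * y := by
      ext z
      have e : (1 - (w - b) * ((z : ℂ) - b)⁻¹) * y z = 1 := congrArg (fun f => f z) hy1
      change g z = ((z : ℂ) - b)⁻¹ * y z
      rw [hg]
      have e1 := hzb z
      have e2 := hzw z
      field_simp at e ⊢
      linear_combination -e
    rw [this]
    exact mul_mem (hsub hc) hy
  · push Not at h1
    have hw0 : w ≠ 0 := by
      rintro rfl
      rw [norm_zero] at h1
      exact absurd h1 (not_lt.2 (Nat.cast_nonneg n))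
    let c : C(hf_K X n, ℂ) := ⟨fun z => (z : ℂ), by fun_prop⟩
    have hc : c ∈ S := ⟨fun z => z, by fun_prop, fun z => rfl⟩
    obtain ⟨y, hy, hy1⟩ := hf_geom S.topologicalClosure hcl (w⁻¹ • c)
      (Subalgebra.smul_mem _ (hsub hc) _) (by
        refine lt_of_le_of_lt ((ContinuousMap.norm_le _ (by positivity :
          0 ≤ ‖w‖⁻¹ * (n : ℝ))).2 fun z => ?_) ?_
        · change ‖w⁻¹ * (z : ℂ)‖ ≤ _
          rw [norm_mul, norm_inv]
          have := z.2.1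
          gcongr
        · rw [inv_mul_eq_div, div_lt_one (norm_pos_iff.2 hw0)]
          exact h1)
    have : g = (-w⁻¹) • y := by
      ext z
      have e : (1 - w⁻¹ * (z : ℂ)) * y z = 1 := congrArg (fun f => f z) hy1
      change g z = (-w⁻¹) * y z
      rw [hg]
      have e2 := hzw z
      field_simp at e ⊢
      linear_combination -e
    rw [this]
    exact Subalgebra.smul_mem _ hy _

open MeasureTheory Filter Topology Complex in
theorem hf_integral_mem {α E : Type*} [MeasurableSpace α] [NormedAddCommGroup E] [NormedSpace ℝ E]
    [CompleteSpace E] (ν : Measure α) [IsFiniteMeasure ν] (S : Submodule ℝ E)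
    (hS : IsClosed (S : Set E)) (f : α → E) (hf : Integrable f ν) (hm : ∀ x, f x ∈ S) :
    ∫ x, f x ∂ν ∈ S := by
  by_cases h : ν = 0
  · simp [h]
  · have : NeZero ν := ⟨h⟩
    have := S.convex.average_mem hS (Eventually.of_forall hm) hf
    rw [← measure_smul_average ν f]
    exact S.smul_mem _ this

open MeasureTheory Filter Topology Complex in
theorem hf_approx (X : Set ℂ) (n : ℕ) (h : ℂ → ℂ) (N D : Set ℂ) (hN : IsCompact N)
    (hNK : ∀ w ∈ N, w ∉ hf_K X n) (hh : ContinuousOn h N) (hD : MeasurableSet D) (hDN : D ⊆ N)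
    (ε : ℝ) (hε : 0 < ε) :
    ∃ P : ℂ → ℂ, DifferentiableOn ℂ P X ∧
      ∀ z ∈ hf_K X n, ‖(∫ w in D, h w / (z - w)) - P z‖ < ε := by
  have : CompactSpace (hf_K X n) := isCompact_iff_compactSpace.1 (hf_K_compact X n)
  have : CompactSpace N := isCompact_iff_compactSpace.1 hN
  set S := hf_alg X (hf_K X n) with hS
  have hne : ∀ p : N × hf_K X n, (p.2 : ℂ) - p.1 ≠ 0 := fun p e =>
    hNK p.1 p.1.2 (by rw [sub_eq_zero] at e; rw [← e]; exact p.2.2)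
  let k : C(N × hf_K X n, ℂ) := ⟨fun p => ((p.2 : ℂ) - p.1)⁻¹,
    Continuous.inv₀ (by fun_prop) hne⟩
  let T : N → C(hf_K X n, ℂ) := fun w => h w • k.curry w
  have hTc : Continuous T :=
    (continuousOn_iff_continuous_domRestrict.1 hh).smul k.curry.continuous
  have hTm : ∀ w, T w ∈ S.topologicalClosure := fun w =>
    Subalgebra.smul_mem _ (hf_kernel_mem X n w (hNK w w.2) _ fun z => rfl) _
  let ν : Measure N := (volume.restrict D).comap Subtype.val
  have hemb : MeasurableEmbedding (Subtype.val : N → ℂ) :=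
    MeasurableEmbedding.subtype_coe hN.isClosed.measurableSet
  have : IsFiniteMeasure (volume.restrict D : Measure ℂ) :=
    ⟨by
      rw [Measure.restrict_apply_univ]
      exact (measure_mono hDN).trans_lt hN.measure_lt_top⟩
  have : IsFiniteMeasure ν := ⟨by
    rw [hemb.comap_apply]
    exact measure_lt_top _ _⟩
  have hTi : Integrable T ν := by
    refine hTc.integrable_of_hasCompactSupport ?_
    exact HasCompactSupport.of_compactSpace T
  have hmem := hf_integral_mem ν (S.topologicalClosure.toSubmodule.restrictScalars ℝ)
    S.isClosed_topologicalClosure T hTi hTm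
  have hmem' : ∫ x, T x ∂ν ∈ closure (S : Set C(hf_K X n, ℂ)) := hmem
  obtain ⟨g, ⟨P, hP, hPg⟩, hg⟩ := Metric.mem_closure_iff.1 hmem' ε hε
  refine ⟨P, hP, fun z hz => ?_⟩
  have e1 : (∫ x, T x ∂ν) ⟨z, hz⟩ = ∫ w in D, h w / (z - w) := by
    have := (ContinuousMap.evalCLM (M := ℂ) ℝ (⟨z, hz⟩ : hf_K X n)).integral_comp_comm hTi
    change (ContinuousMap.evalCLM (M := ℂ) ℝ (⟨z, hz⟩ : hf_K X n)) _ = _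
    rw [← this]
    change ∫ x : N, h x * ((z : ℂ) - x)⁻¹ ∂ν = _
    have e2 := integral_subtype_comap (μ := volume.restrict D) hN.isClosed.measurableSet
      (fun w => h w * (z - w)⁻¹)
    rw [e2, Measure.restrict_restrict hN.isClosed.measurableSet, inter_eq_right.2 hDN]
    simp_rw [div_eq_mul_inv]
  rw [← e1, ← hPg ⟨z, hz⟩, ← dist_eq_norm]
  exact (ContinuousMap.dist_apply_le_dist _).trans_lt hg

open MeasureTheory Filter Topology Complex in
theorem hf_ind (h : ℂ → ℂ) (A : Set ℂ) (hA : MeasurableSet A) (z : ℂ) :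
    ∫ w, A.indicator h w / (z - w) = ∫ w in A, h w / (z - w) := by
  rw [← integral_indicator hA]
  congr 1
  ext w
  by_cases hw : w ∈ A <;> simp [hw]

open MeasureTheory Filter Topology Complex in
theorem hf_ind_integrable (h : ℂ → ℂ) (A K : Set ℂ) (hA : MeasurableSet A) (hK : IsCompact K)
    (hAK : A ⊆ K) (hh : ContinuousOn h K) : Integrable (A.indicator h) :=
  (integrable_indicator_iff hA).2 ((hh.integrableOn_compact hK).mono_set hAK)

open MeasureTheory Filter Topology Complex in
theorem hf_ind_kernel (h : ℂ → ℂ) (A K : Set ℂ) (hA : MeasurableSet A) (hK : IsCompact K)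
    (hAK : A ⊆ K) (hh : ContinuousOn h K) (z : ℂ) :
    Integrable (fun w => A.indicator h w / (z - w)) := by
  obtain ⟨C, hC⟩ := hK.exists_bound_of_continuousOn hh
  obtain ⟨R, hR⟩ := hK.isBounded.subset_ball 0
  refine hf_integrable_kernel _ (hf_ind_integrable h A K hA hK hAK hh).1 (max C 0) R ?_ ?_ z
  · intro w
    by_cases hw : w ∈ A
    · rw [indicator_of_mem hw]
      exact (hC w (hAK hw)).trans (le_max_left _ _)
    · rw [indicator_of_notMem hw, norm_zero]
      exact le_max_right _ _
  · intro w hw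
    refine indicator_of_notMem (fun h' => ?_) _
    have := hR (hAK h')
    rw [mem_ball_zero_iff] at this
    linarith

open MeasureTheory Filter Topology Complex in
theorem hf_u (X : Set ℂ) (hX : IsOpen X) (h : ℂ → ℂ) (hh : ContinuousOn h X) :
    ∃ u : ℂ → ℂ, ∀ z₀ ∈ X, ∃ n, z₀ ∈ interior (hf_K X n) ∧
      DifferentiableAt ℂ (fun z => u z - ∫ w, (hf_K X n).indicator h w / (z - w)) z₀ := by
  have hms : ∀ n, MeasurableSet (hf_K X n) := fun n => (hf_K_compact X n).isClosed.measurableSet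
  have hhK : ∀ n, ContinuousOn h (hf_K X n) := fun n => hh.mono (hf_K_subset X n)
  set C : ℕ → ℂ → ℂ := fun n z => ∫ w, (hf_K X n).indicator h w / (z - w) with hC
  set D : ℕ → Set ℂ := fun n => hf_K X (n + 2) \ hf_K X (n + 1) with hD
  have hDm : ∀ n, MeasurableSet (D n) := fun n => (hms _).diff (hms _)
  set v : ℕ → ℂ → ℂ := fun n z => ∫ w, (D n).indicator h w / (z - w) with hv
  have hvC : ∀ n z, v n z = C (n + 2) z - C (n + 1) z := by
    intro n z
    simp only [hv, hC]
    rw [← integral_sub (hf_ind_kernel h _ _ (hms _) (hf_K_compact X _) subset_rfl (hhK _) z)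
      (hf_ind_kernel h _ _ (hms _) (hf_K_compact X _) subset_rfl (hhK _) z)]
    congr 1
    ext w
    rw [← sub_div]
    congr 1
    have hsub := hf_K_mono X (Nat.le_succ (n + 1))
    by_cases h1 : w ∈ hf_K X (n + 1)
    · have h2 : w ∈ hf_K X (n + 2) := hsub h1
      simp [hD, h1, h2]
    · by_cases h2 : w ∈ hf_K X (n + 2) <;> simp [hD, h1, h2]
  have happ : ∀ n, ∃ P : ℂ → ℂ, DifferentiableOn ℂ P X ∧
      ∀ z ∈ hf_K X n, ‖v n z - P z‖ < (1 / 2 : ℝ) ^ n := by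
    intro n
    obtain ⟨P, hP, hP2⟩ := hf_approx X n h (hf_K X (n + 2) \ interior (hf_K X (n + 1))) (D n)
      ((hf_K_compact X _).diff isOpen_interior) (fun w hw h' => hw.2 (hf_K_interior X n h'))
      ((hhK (n + 2)).mono sdiff_subset) (hDm n)
      (fun w hw => ⟨hw.1, fun h' => hw.2 (interior_subset h')⟩) ((1 / 2 : ℝ) ^ n) (by positivity)
    refine ⟨P, hP, fun z hz => ?_⟩
    simp only [hv]
    rw [hf_ind h _ (hDm n)]
    exact hP2 z hz
  choose P hP hP2 using happ
  refine ⟨fun z => C 1 z + ∑' n, (v n z - P n z), fun z₀ hz₀ => ?_⟩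
  obtain ⟨m, hm⟩ := hf_K_exhaust X hX z₀ hz₀
  refine ⟨m + 2, ?_, ?_⟩
  · exact hf_K_interior X (m + 1) (hf_K_mono X (Nat.le_succ m) hm)
  change DifferentiableAt ℂ (fun z => C 1 z + ∑' n, (v n z - P n z) - C (m + 2) z) z₀
  have hm1 : z₀ ∈ interior (hf_K X (m + 1)) := hf_K_interior X m hm
  set U := interior (hf_K X (m + 1)) with hU
  have hbound : ∀ i, ∀ z ∈ U, ‖v (i + (m + 1)) z - P (i + (m + 1)) z‖ ≤ (1 / 2 : ℝ) ^ i := by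
    intro i z hz
    refine (hP2 _ z (hf_K_mono X (Nat.le_add_left _ _) (interior_subset hz))).le.trans ?_
    exact pow_le_pow_of_le_one (by norm_num) (by norm_num) (Nat.le_add_right _ _)
  have hgeo : Summable fun i : ℕ => (1 / 2 : ℝ) ^ i := summable_geometric_two
  have htail : DifferentiableOn ℂ (fun z => ∑' i, (v (i + (m + 1)) z - P (i + (m + 1)) z)) U := by
    refine Complex.differentiableOn_tsum_of_summable_norm hgeo (fun i => ?_) isOpen_interior hbound
    refine DifferentiableOn.sub ?_ ((hP _).mono (interior_subset.trans (hf_K_subset X _)))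
    intro z hz
    refine (hf_holo _ (hf_ind_integrable h _ (hf_K X (i + (m + 1) + 2)) (hDm _) (hf_K_compact X _)
      sdiff_subset (hhK _)) z ?_).differentiableWithinAt
    filter_upwards [isOpen_interior.mem_nhds hz] with w hw
    refine indicator_of_notMem (fun h' => h'.2 ?_) _
    exact hf_K_mono X (by omega) (interior_subset hw)
  have hfin : DifferentiableAt ℂ (fun z => - ∑ i ∈ Finset.range (m + 1), P i z +
      ∑' i, (v (i + (m + 1)) z - P (i + (m + 1)) z)) z₀ := by
    refine DifferentiableAt.add (DifferentiableAt.neg ?_)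
      (htail.differentiableAt (isOpen_interior.mem_nhds hm1))
    exact DifferentiableAt.fun_sum fun i _ => (hP i).differentiableAt (hX.mem_nhds hz₀)
  refine hfin.congr_of_eventuallyEq ?_
  filter_upwards [isOpen_interior.mem_nhds hm1] with z hz
  have hs : Summable fun i => v (i + (m + 1)) z - P (i + (m + 1)) z :=
    Summable.of_norm_bounded hgeo fun i => hbound i z hz
  have hs' : Summable fun i => v i z - P i z := (summable_nat_add_iff (m + 1)).1 hs
  rw [← hs'.sum_add_tsum_nat_add (m + 1), Finset.sum_sub_distrib]
  have htel : ∑ i ∈ Finset.range (m + 1), v i z = C (m + 2) z - C 1 z := by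
    have := Finset.sum_range_sub (fun i => C (i + 1) z) (m + 1)
    rw [← this]
    exact Finset.sum_congr rfl fun i _ => hvC i z
  rw [htel]
  ring

open MeasureTheory Filter Topology Complex in
theorem hf_dbar_solve (X : Set ℂ) (hX : IsOpen X) (h : ℂ → ℂ) (hh : ContinuousOn h X) :
    ∃ u : ℂ → ℂ, ∀ z₀ ∈ X, ∀ φ : ℂ → ℂ, ContDiff ℝ 1 φ → HasCompactSupport φ →
      (∀ᶠ w in 𝓝 z₀, hf_dbar φ w = h w) → DifferentiableAt ℂ (fun z => φ z - u z) z₀ := by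
  obtain ⟨u, hu⟩ := hf_u X hX h hh
  refine ⟨fun z => (2 * Real.pi : ℂ)⁻¹ * u z, fun z₀ hz₀ φ hφ hc he => ?_⟩
  obtain ⟨n, hn, hd⟩ := hu z₀ hz₀
  have hpi : (2 * Real.pi : ℂ) ≠ 0 := by
    simp [Real.pi_ne_zero]
  have hdc : Continuous (fderiv ℝ φ) := hφ.continuous_fderiv (by simp)
  have hbc : Continuous (hf_dbar φ) := by
    unfold hf_dbar
    exact (hdc.clm_apply continuous_const).add (continuous_const.mul (hdc.clm_apply continuous_const))
  have hz0 : ∀ w, w ∉ tsupport φ → hf_dbar φ w = 0 := by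
    intro w hw
    have : fderiv ℝ φ w = 0 :=
      image_eq_zero_of_notMem_tsupport fun h => hw (tsupport_fderiv_subset ℝ h)
    simp [hf_dbar, this]
  have hbeq : (tsupport φ).indicator (hf_dbar φ) = hf_dbar φ := by
    ext w
    by_cases hw : w ∈ tsupport φ
    · rw [indicator_of_mem hw]
    · rw [indicator_of_notMem hw, hz0 w hw]
  have hmt := (isClosed_tsupport φ).measurableSet
  have hmk := (hf_K_compact X n).isClosed.measurableSet
  have hhk := hh.mono (hf_K_subset X n)
  have hi1 := hf_ind_integrable (hf_dbar φ) _ _ hmt hc.isCompact subset_rfl hbc.continuousOn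
  have hk1 := hf_ind_kernel (hf_dbar φ) _ _ hmt hc.isCompact subset_rfl hbc.continuousOn
  rw [hbeq] at hi1 hk1
  have hi2 := hf_ind_integrable h _ _ hmk (hf_K_compact X n) subset_rfl hhk
  have hk2 := hf_ind_kernel h _ _ hmk (hf_K_compact X n) subset_rfl hhk
  have hd2 := hf_holo (fun w => hf_dbar φ w - (hf_K X n).indicator h w) (hi1.sub hi2) z₀ (by
    filter_upwards [he, isOpen_interior.mem_nhds hn] with w h1 h2
    rw [indicator_of_mem (interior_subset h2), h1, sub_self])
  have hd3 := (hd2.sub hd).const_mul (2 * Real.pi : ℂ)⁻¹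
  refine hd3.congr_of_eventuallyEq (Eventually.of_forall fun z => ?_)
  have e1 : ∫ w, (hf_dbar φ w - (hf_K X n).indicator h w) / (z - w) =
      2 * Real.pi * φ z - ∫ w, (hf_K X n).indicator h w / (z - w) := by
    rw [← hf_pompeiu φ hφ hc z, ← integral_sub (hk1 z) (hk2 z)]
    simp_rw [sub_div]
  simp only [Pi.sub_apply, e1]
  field_simp
  ring

open Filter Topology in
theorem hf_cutoff (X₁ X₂ M : Set ℂ) (hX₁ : IsOpen X₁) (hM : IsOpen (X₂ \ M)) (hM₁ : M ⊆ X₁)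
    (h₁₂ : X₁ ⊆ X₂) : ∃ χ : ℂ → ℂ, (∀ z ∈ X₂, ContDiffAt ℝ 2 χ z) ∧
      (∀ z ∈ M, ∀ᶠ w in 𝓝 z, χ w = 1) ∧ (∀ z ∈ X₂ \ X₁, ∀ᶠ w in 𝓝 z, χ w = 0) := by
  obtain ⟨a, ha, had, har⟩ := hX₁.exists_contDiff_support_eq (n := 2)
  obtain ⟨b, hb, hbd, hbr⟩ := hM.exists_contDiff_support_eq (n := 2)
  have ha0 : ∀ z, 0 ≤ a z := fun z => (har (mem_range_self z)).1
  have hb0 : ∀ z, 0 ≤ b z := fun z => (hbr (mem_range_self z)).1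
  have hane : ∀ z, a z ≠ 0 ↔ z ∈ X₁ := fun z => by rw [← ha]; rfl
  have hbne : ∀ z, b z ≠ 0 ↔ z ∈ X₂ \ M := fun z => by rw [← hb]; rfl
  have hpos : ∀ z ∈ X₂, a z + b z ≠ 0 := by
    intro z hz h
    have h1 : a z = 0 := by linarith [ha0 z, hb0 z]
    have h2 : b z = 0 := by linarith [ha0 z, hb0 z]
    have h3 : z ∉ X₁ := fun h' => (hane z).2 h' h1
    exact (hbne z).2 ⟨hz, fun h' => h3 (hM₁ h')⟩ h2
  set q : ℂ → ℝ := fun z => 3 * (a z / (a z + b z)) - 1 with hq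
  have hqd : ∀ z ∈ X₂, ContDiffAt ℝ 2 q z := fun z hz =>
    (contDiffAt_const.mul (had.contDiffAt.div (had.contDiffAt.add hbd.contDiffAt) (hpos z hz))).sub
      contDiffAt_const
  refine ⟨fun z => (Real.smoothTransition (q z) : ℂ), fun z hz => ?_, fun z hz => ?_, fun z hz => ?_⟩
  · exact Complex.ofRealCLM.contDiff.contDiffAt.comp z
      (Real.smoothTransition.contDiff.contDiffAt.comp z (hqd z hz))
  · have h1 : a z ≠ 0 := (hane z).2 (hM₁ hz)
    have h2 : b z = 0 := by
      by_contra h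
      exact ((hbne z).1 h).2 hz
    have h3 : 1 < q z := by simp only [hq, h2, add_zero, div_self h1]; norm_num
    filter_upwards [(hqd z (h₁₂ (hM₁ hz))).continuousAt.eventually (lt_mem_nhds h3)] with w hw
    rw [Real.smoothTransition.one_of_one_le hw.le, Complex.ofReal_one]
  · have h1 : a z = 0 := by
      by_contra h
      exact hz.2 ((hane z).1 h)
    have h3 : q z < 0 := by simp [hq, h1]
    filter_upwards [(hqd z hz.1).continuousAt.eventually (gt_mem_nhds h3)] with w hw
    rw [Real.smoothTransition.zero_of_nonpos hw.le, Complex.ofReal_zero]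

theorem hf_dbar_mul (χ f : ℂ → ℂ) (z : ℂ) (hχ : DifferentiableAt ℝ χ z)
    (hf : DifferentiableAt ℂ f z) : hf_dbar (fun w => χ w * f w) z = f z * hf_dbar χ z := by
  have h1 : HasFDerivAt f ((fderiv ℂ f z).restrictScalars ℝ) z := hf.hasFDerivAt.restrictScalars ℝ
  have h2 := (hχ.hasFDerivAt.mul h1).fderiv
  have h3 : fderiv ℂ f z Complex.I = Complex.I * fderiv ℂ f z 1 := by
    simp
  unfold hf_dbar
  change (fderiv ℝ (χ * f) z) 1 + Complex.I * (fderiv ℝ (χ * f) z) Complex.I = _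
  rw [h2]
  simp [h3]
  linear_combination (χ z * deriv f z) * Complex.I_sq

theorem hf_dbar_congr {φ ψ : ℂ → ℂ} {z : ℂ} (h : φ =ᶠ[nhds z] ψ) : hf_dbar φ z = hf_dbar ψ z := by
  unfold hf_dbar
  rw [h.fderiv_eq]

open Filter Topology in
theorem hf_split (X₁ X₂ M : Set ℂ) (hX₁ : IsOpen X₁) (hX₂ : IsOpen X₂) (hM : IsOpen (X₂ \ M))
    (hM₁ : M ⊆ X₁) (h₁₂ : X₁ ⊆ X₂) (f : ℂ → ℂ) (hf : DifferentiableOn ℂ f (X₁ \ M)) :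
    ∃ F g : ℂ → ℂ, DifferentiableOn ℂ F (X₂ \ M) ∧ DifferentiableOn ℂ g X₁ ∧
      ∀ z ∈ X₁ \ M, f z = F z + g z := by
  classical
  obtain ⟨χ, hχ, hχ1, hχ0⟩ := hf_cutoff X₁ X₂ M hX₁ hM hM₁ h₁₂
  set W := X₁ \ M with hW
  have hWo : IsOpen W := by
    have : W = X₁ ∩ (X₂ \ M) := by
      ext z
      exact ⟨fun h => ⟨h.1, h₁₂ h.1, h.2⟩, fun h => ⟨h.1, h.2.2⟩⟩
    rw [this]
    exact hX₁.inter hM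
  have hWX : W ⊆ X₂ := fun z hz => h₁₂ hz.1
  have hfa : ∀ z ∈ W, DifferentiableAt ℂ f z := fun z hz => hf.differentiableAt (hWo.mem_nhds hz)
  have hconst : ∀ (c z : ℂ), (∀ᶠ w in 𝓝 z, χ w = c) → ∀ᶠ w in 𝓝 z, hf_dbar χ w = 0 := by
    intro c z h
    filter_upwards [h.eventually_nhds] with w hw
    rw [hf_dbar_congr (ψ := fun _ => c) hw]
    simp [hf_dbar]
  set h : ℂ → ℂ := W.indicator (fun z => f z * hf_dbar χ z) with hh
  have hh0 : ∀ z, (∀ᶠ w in 𝓝 z, hf_dbar χ w = 0) → ∀ᶠ w in 𝓝 z, h w = 0 := by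
    intro z hz
    filter_upwards [hz] with w hw
    by_cases h1 : w ∈ W
    · rw [hh, indicator_of_mem h1, hw, mul_zero]
    · rw [hh, indicator_of_notMem h1]
  have hcases : ∀ z ∈ X₂, z ∈ W ∨ z ∈ M ∨ z ∈ X₂ \ X₁ := by
    intro z hz
    by_cases h1 : z ∈ X₁
    · by_cases h2 : z ∈ M
      · exact Or.inr (Or.inl h2)
      · exact Or.inl ⟨h1, h2⟩
    · exact Or.inr (Or.inr ⟨hz, h1⟩)
  have hhc : ContinuousOn h X₂ := by
    intro z hz
    have hz' : ∀ c : ℂ, (∀ᶠ w in 𝓝 z, χ w = c) → ContinuousWithinAt h X₂ z := fun c hc =>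
      (continuousAt_const.congr (f := fun _ => (0 : ℂ))
        ((hh0 z (hconst c z hc)).mono fun w hw => hw.symm)).continuousWithinAt
    rcases hcases z hz with h1 | h1 | h1
    · have h2 : ContinuousAt (fun z => f z * hf_dbar χ z) z := by
        have h3 : ContinuousAt (fderiv ℝ χ) z :=
          ((hχ z hz).fderiv_right (m := 1) (by norm_num)).continuousAt
        refine (hfa z h1).continuousAt.mul ?_
        unfold hf_dbar
        exact (h3.clm_apply continuousAt_const).add
          (continuousAt_const.mul (h3.clm_apply continuousAt_const))
      refine (h2.congr ?_).continuousWithinAt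
      filter_upwards [hWo.mem_nhds h1] with w hw
      rw [hh, indicator_of_mem hw]
    · exact hz' 1 (hχ1 z h1)
    · exact hz' 0 (hχ0 z h1)
  obtain ⟨u, hu⟩ := hf_dbar_solve X₂ hX₂ h hhc
  have hu0 : ∀ z ∈ X₂, ∀ c : ℂ, (∀ᶠ w in 𝓝 z, χ w = c) → DifferentiableAt ℂ u z := by
    intro z hz c hc
    have h1 := hu z hz (fun _ => 0) contDiff_const HasCompactSupport.zero (by
      filter_upwards [hh0 z (hconst c z hc)] with w hw
      rw [hw]
      simp [hf_dbar])
    have h2 := h1.neg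
    refine h2.congr_of_eventuallyEq (Eventually.of_forall fun w => ?_)
    simp
  have huW : ∀ z ∈ W, DifferentiableAt ℂ (fun w => χ w * f w - u w) z := by
    intro z hz
    obtain ⟨r, hr, hrW⟩ := Metric.isOpen_iff.1 hWo z hz
    let ψ : ContDiffBump z := ⟨r / 4, r / 2, by positivity, by linarith⟩
    have hts : tsupport (fun w => ψ w • (χ w * f w)) ⊆ W := by
      refine (closure_mono (?_ : _ ⊆ Function.support ψ)).trans ?_
      · intro w hw hw'
        exact hw (by simp [hw'])
      change tsupport ψ ⊆ W
      rw [ψ.tsupport_eq]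
      exact (Metric.closedBall_subset_ball (by change r / 2 < r; linarith)).trans hrW
    have hψ1 : ∀ᶠ w in 𝓝 z, ψ w • (χ w * f w) = χ w * f w := by
      filter_upwards [ψ.eventuallyEq_one] with w hw
      rw [hw]; simp
    have h1 := hu z (hWX hz) (fun w => ψ w • (χ w * f w)) ?_ ?_ ?_
    · refine h1.congr_of_eventuallyEq ?_
      filter_upwards [hψ1] with w hw
      rw [hw]
    · refine contDiff_iff_contDiffAt.2 fun w => ?_
      by_cases hw : w ∈ tsupport (fun w => ψ w • (χ w * f w))
      swap
      · refine (contDiffAt_const (c := (0 : ℂ))).congr_of_eventuallyEq ?_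
        exact notMem_tsupport_iff_eventuallyEq.1 hw
      have hwW := hts hw
      have hfw : ContDiffAt ℝ 1 f w :=
        ((hf.contDiffOn hWo (n := 1)).contDiffAt (hWo.mem_nhds hwW)).restrict_scalars ℝ
      exact ψ.contDiffAt.smul (((hχ w (hWX hwW)).of_le (by norm_num)).mul hfw)
    · exact ψ.hasCompactSupport.smul_right
    · filter_upwards [hψ1.eventually_nhds, hWo.mem_nhds hz] with w hw hwW
      rw [hf_dbar_congr hw, hf_dbar_mul χ f w ((hχ w (hWX hwW)).differentiableAt (by norm_num))
        (hfa w hwW), hh, indicator_of_mem hwW]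
  refine ⟨fun z => W.indicator (fun z => χ z * f z) z - u z,
    fun z => W.indicator (fun z => (1 - χ z) * f z) z + u z, ?_, ?_, ?_⟩
  · intro z hz
    refine DifferentiableAt.differentiableWithinAt ?_
    rcases hcases z hz.1 with h1 | h1 | h1
    · refine (huW z h1).congr_of_eventuallyEq ?_
      filter_upwards [hWo.mem_nhds h1] with w hw
      rw [indicator_of_mem hw]
    · exact absurd h1 hz.2
    · refine (hu0 z hz.1 0 (hχ0 z h1)).neg.congr_of_eventuallyEq ?_
      filter_upwards [hχ0 z h1] with w hw
      by_cases hwW : w ∈ W <;> simp [hwW, hw]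
  · intro z hz
    refine DifferentiableAt.differentiableWithinAt ?_
    rcases hcases z (h₁₂ hz) with h1 | h1 | h1
    · refine ((hfa z h1).sub (huW z h1)).congr_of_eventuallyEq ?_
      filter_upwards [hWo.mem_nhds h1] with w hw
      rw [indicator_of_mem hw]
      simp only [Pi.sub_apply]
      ring
    · refine (hu0 z (h₁₂ hz) 1 (hχ1 z h1)).congr_of_eventuallyEq ?_
      filter_upwards [hχ1 z h1] with w hw
      by_cases hwW : w ∈ W <;> simp [hwW, hw]
    · exact absurd hz h1.2
  · intro z hz
    simp only [indicator_of_mem hz]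
    ring

/-- If `X₁ ⊆ X₂` are open in `ℂ` with `X₁ ∩ ℝ = X₂ ∩ ℝ = M`, the restriction map
`O(X₂ ∖ M) → O(X₁ ∖ M)` induces a linear isomorphism
`O(X₂ ∖ M)/O(X₂) ≅ O(X₁ ∖ M)/O(X₁)`: the space of hyperfunctions `B(M)` is independent
of the choice of the complex neighborhood `X`. -/
theorem hyperfunctions_independent_of_neighborhood
    (X₁ X₂ : Set ℂ) (M : Set ℂ) (hX₁ : IsOpen X₁) (hX₂ : IsOpen X₂) (h₁₂ : X₁ ⊆ X₂)
    (hM₁ : X₁ ∩ realAxis = M) (hM₂ : X₂ ∩ realAxis = M) :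
    ∃ e : Hyperfunctions X₂ M ≃ₗ[ℂ] Hyperfunctions X₁ M,
      ∀ (f : ℂ → ℂ) (hf : DifferentiableOn ℂ f (X₂ \ M)),
        e (Submodule.Quotient.mk ⟨f, hf⟩) =
          Submodule.Quotient.mk ⟨f, hf.mono (diff_subset_diff_left h₁₂)⟩ := by
  classical
  have hMX : M ⊆ X₁ := by rw [← hM₁]; exact inter_subset_left
  have hMo : IsOpen (X₂ \ M) := by
    have h1 : X₂ \ M = X₂ \ realAxis := by
      rw [← hM₂]; ext z; simp
    rw [h1]
    exact hX₂.sdiff (isClosed_eq Complex.continuous_im continuous_const)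
  let Φ : ↥(holo (X₂ \ M)) →ₗ[ℂ] ↥(holo (X₁ \ M)) :=
    { toFun := fun f => ⟨f.1, DifferentiableOn.mono f.2 (diff_subset_diff_left h₁₂)⟩
      map_add' := fun _ _ => rfl
      map_smul' := fun _ _ => rfl }
  have hle : holoExt X₂ M ≤ (holoExt X₁ M).comap Φ := by
    rintro f ⟨g, hg, hfg⟩
    exact ⟨g, hg.mono h₁₂, hfg.mono (diff_subset_diff_left h₁₂)⟩
  let Ψ := (holoExt X₂ M).mapQ (holoExt X₁ M) Φ hle
  have hinj : Function.Injective Ψ := by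
    rw [injective_iff_map_eq_zero]
    intro x hx
    obtain ⟨f, rfl⟩ := Submodule.Quotient.mk_surjective _ x
    have hx' : Submodule.Quotient.mk (p := holoExt X₁ M) (Φ f) = 0 := hx
    rw [Submodule.Quotient.mk_eq_zero] at hx' ⊢
    obtain ⟨g, hg, hfg⟩ := hx'
    have hfg' : ∀ z ∈ X₁ \ M, f.1 z = g z := fun z hz => hfg hz
    have hfd : DifferentiableOn ℂ f.1 (X₂ \ M) := f.2
    refine ⟨fun z => if z ∈ X₁ then g z else f.1 z, ?_, ?_⟩
    · intro z hz
      refine DifferentiableAt.differentiableWithinAt ?_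
      by_cases h1 : z ∈ X₁
      · refine (hg.differentiableAt (hX₁.mem_nhds h1)).congr_of_eventuallyEq ?_
        filter_upwards [hX₁.mem_nhds h1] with w hw
        simp [hw]
      · have h2 : z ∈ X₂ \ M := ⟨hz, fun h => h1 (hMX h)⟩
        refine (hfd.differentiableAt (hMo.mem_nhds h2)).congr_of_eventuallyEq ?_
        filter_upwards [hMo.mem_nhds h2] with w hw
        by_cases h3 : w ∈ X₁
        · simp [h3, hfg' w ⟨h3, hw.2⟩]
        · simp [h3]
    · intro z hz
      by_cases h3 : z ∈ X₁
      · simp [h3, hfg' z ⟨h3, hz.2⟩]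
      · simp [h3]
  have hsurj : Function.Surjective Ψ := by
    intro y
    obtain ⟨f, rfl⟩ := Submodule.Quotient.mk_surjective _ y
    obtain ⟨F, g, hF, hg, hfFg⟩ := hf_split X₁ X₂ M hX₁ hX₂ hMo hMX h₁₂ f.1 f.2
    refine ⟨Submodule.Quotient.mk ⟨F, hF⟩, ?_⟩
    change Submodule.Quotient.mk (p := holoExt X₁ M) (Φ ⟨F, hF⟩) = _
    rw [Submodule.Quotient.eq]
    refine ⟨-g, hg.neg, fun z hz => ?_⟩
    change F z - f.1 z = - g z
    rw [hfFg z hz]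
    ring
  exact ⟨LinearEquiv.ofBijective Ψ ⟨hinj, hsurj⟩, fun f hf => rfl⟩
end

section
/- Let X₁ ⊆ X₂ be open subsets of ℂ with X₁ ∩ ℝ = X₂ ∩ ℝ = M (where ℝ is regarded as the real axis in ℂ). Let f be holomorphic on X₂ ∖ M and suppose there exists h holomorphic on X₁ with h(z) = f(z) for all z ∈ X₁ ∖ M. Then there exists F holomorphic on X₂ with F(z) = f(z) for all z ∈ X₂ ∖ M. -/
open Set

/-- Injectivity half of the independence of hyperfunctions on the complex neighborhood:
if `X₁ ⊆ X₂` are open in `ℂ` with `X₁ ∩ ℝ = X₂ ∩ ℝ = M`, and `f` is holomorphic on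
`X₂ ∖ M` and agrees on `X₁ ∖ M` with a function holomorphic on `X₁`, then `f` agrees on
`X₂ ∖ M` with a function holomorphic on `X₂`. -/
theorem hyperfunction_restriction_injective
    (X₁ X₂ : Set ℂ) (M : Set ℂ) (hX₁ : IsOpen X₁) (hX₂ : IsOpen X₂) (h₁₂ : X₁ ⊆ X₂)
    (hM₁ : X₁ ∩ realAxis = M) (hM₂ : X₂ ∩ realAxis = M)
    (f : ℂ → ℂ) (hf : DifferentiableOn ℂ f (X₂ \ M))
    (h : ℂ → ℂ) (hh : DifferentiableOn ℂ h X₁) (hfh : ∀ z ∈ X₁ \ M, h z = f z) :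
    ∃ F : ℂ → ℂ, DifferentiableOn ℂ F X₂ ∧ ∀ z ∈ X₂ \ M, F z = f z := by
  classical
  have hcl : IsClosed realAxis := isClosed_eq Complex.continuous_im continuous_const
  have hXM : X₂ \ M = X₂ \ realAxis := by
    rw [← hM₂, diff_self_inter]
  have hop : IsOpen (X₂ \ M) := by
    rw [hXM]
    exact hX₂.sdiff hcl
  have hF : ∀ z ∈ X₂ \ M, (if z ∈ X₁ then h z else f z) = f z := by
    intro z hz
    by_cases h1 : z ∈ X₁
    · rw [if_pos h1]
      exact hfh z ⟨h1, hz.2⟩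
    · rw [if_neg h1]
  refine ⟨fun z => if z ∈ X₁ then h z else f z, ?_, hF⟩
  intro z hz
  apply DifferentiableAt.differentiableWithinAt
  by_cases h1 : z ∈ X₁
  · refine (hh.differentiableAt (hX₁.mem_nhds h1)).congr_of_eventuallyEq ?_
    filter_upwards [hX₁.mem_nhds h1] with w hw
    exact if_pos hw
  · have hz' : z ∈ X₂ \ M := ⟨hz, fun hm => h1 (by rw [← hM₁] at hm; exact hm.1)⟩
    refine (hf.differentiableAt (hop.mem_nhds hz')).congr_of_eventuallyEq ?_
    filter_upwards [hop.mem_nhds hz'] with w hw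
    exact hF w hw
end

section
/- Let X₁ ⊆ X₂ be open subsets of ℂ with X₁ ∩ ℝ = X₂ ∩ ℝ = M (where ℝ is regarded as the real axis in ℂ). Then for every g holomorphic on X₁ ∖ M there exist f holomorphic on X₂ ∖ M and h holomorphic on X₁ such that g(z) = f(z) + h(z) for all z ∈ X₁ ∖ M. -/
open Set

open Complex MeasureTheory Filter Topology
open scoped Convolution ContDiff Manifold

/-- `u` is real differentiable at `z` and `(∂ₓ + i ∂ᵧ) u (z) = a`. -/
def DbarAt (u : ℂ → ℂ) (a z : ℂ) : Prop :=
  ∃ L : ℂ →L[ℝ] ℂ, HasFDerivAt u L z ∧ L 1 + I * L I = a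

lemma DbarAt.add {u v : ℂ → ℂ} {a b z : ℂ} (hu : DbarAt u a z) (hv : DbarAt v b z) :
    DbarAt (fun x => u x + v x) (a + b) z := by
  obtain ⟨L, h1, h2⟩ := hu
  obtain ⟨K, h3, h4⟩ := hv
  refine ⟨L + K, h1.add h3, ?_⟩
  rw [← h2, ← h4]; simp; ring

lemma DbarAt.of_differentiableAt {u : ℂ → ℂ} {z : ℂ} (hu : DifferentiableAt ℂ u z) :
    DbarAt u 0 z := by
  have h := differentiableAt_complex_iff_differentiableAt_real.1 hu
  refine ⟨fderiv ℝ u z, h.1.hasFDerivAt, ?_⟩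
  rw [h.2, smul_eq_mul, ← mul_assoc, I_mul_I]; ring

lemma DbarAt.differentiableAt {u : ℂ → ℂ} {z : ℂ} (hu : DbarAt u 0 z) :
    DifferentiableAt ℂ u z := by
  obtain ⟨L, h1, h2⟩ := hu
  refine differentiableAt_complex_iff_differentiableAt_real.2 ⟨h1.differentiableAt, ?_⟩
  rw [h1.fderiv, smul_eq_mul]
  have h3 := I_mul_I
  linear_combination (-I) * h2 + L I * h3

lemma DbarAt.mul {u v : ℂ → ℂ} {a b z : ℂ} (hu : DbarAt u a z) (hv : DbarAt v b z) :
    DbarAt (fun x => v x * u x) (v z * a + b * u z) z := by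
  obtain ⟨L, h1, h2⟩ := hu
  obtain ⟨K, h3, h4⟩ := hv
  refine ⟨_, h3.mul h1, ?_⟩
  rw [← h2, ← h4]; simp; ring

lemma DbarAt.sum {ι : Type*} (s : Finset ι) {u : ι → ℂ → ℂ} {a : ι → ℂ} {z : ℂ}
    (h : ∀ i ∈ s, DbarAt (u i) (a i) z) :
    DbarAt (fun x => ∑ i ∈ s, u i x) (∑ i ∈ s, a i) z := by
  classical
  induction s using Finset.induction_on with
  | empty => simpa using DbarAt.of_differentiableAt (differentiableAt_const (0 : ℂ))
  | insert i s hi ih =>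
    simp only [Finset.sum_insert hi]
    exact (h i (by simp)).add (ih fun j hj => h j (by simp [hj]))

lemma DbarAt.congr {u v : ℂ → ℂ} {a z : ℂ} (hu : DbarAt u a z) (h : v =ᶠ[𝓝 z] u) :
    DbarAt v a z := by
  obtain ⟨L, h1, h2⟩ := hu
  exact ⟨L, h1.congr_of_eventuallyEq h, h2⟩

lemma clm_complex (L : ℂ →L[ℝ] ℂ) (w : ℂ) : L w = w.re * L 1 + w.im * L I := by
  conv_lhs => rw [show w = w.re • (1 : ℂ) + w.im • I by simp [re_add_im]]
  rw [map_add, map_smul, map_smul, real_smul, real_smul]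

lemma locInt_inv : LocallyIntegrable (fun t : ℂ => t⁻¹) := by
  refine locallyIntegrable_of_norm_le_rpow (C := 1) (α := 1) ?_ ?_ ?_ ?_
  · simp [finrank_real_complex]
  · simp [finrank_real_complex]
  · filter_upwards with x
    simp [Real.rpow_neg_one]
  · exact measurable_inv.aestronglyMeasurable

lemma locInt_inv_norm : LocallyIntegrable (fun t : ℂ => ‖t⁻¹‖) :=
  fun x => (locInt_inv x).norm

/-- Pompeiu formula at the origin. -/
lemma pompeiu {G : ℂ → ℂ} (hG : ContDiff ℝ 1 G) (hc : HasCompactSupport G) :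
    ∫ t : ℂ, t⁻¹ * (fderiv ℝ G t 1 + I * fderiv ℝ G t I) = - (2 * Real.pi * G 0) := by
  obtain ⟨R, hR, hRs⟩ := hc.isCompact.isBounded.exists_pos_norm_lt
  have hG0 : ∀ t : ℂ, R ≤ ‖t‖ → G t = 0 := fun t ht => by
    by_contra h
    exact absurd (hRs t (subset_tsupport _ h)) (not_lt.2 ht)
  have hG1 : ∀ t : ℂ, R ≤ ‖t‖ → fderiv ℝ G t = 0 := fun t ht => by
    by_contra h
    exact absurd (hRs t (support_fderiv_subset ℝ h)) (not_lt.2 ht)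
  have hd : ∀ t, HasFDerivAt G (fderiv ℝ G t) t := fun t =>
    (hG.differentiable one_ne_zero t).hasFDerivAt
  have hcf : Continuous (fderiv ℝ G) := hG.continuous_fderiv one_ne_zero
  set E : ℝ → ℂ := fun θ => (Real.cos θ : ℂ) + Real.sin θ * I with hE
  have hEc : Continuous E := by fun_prop
  have hEn : ∀ (r θ : ℝ), ‖(r : ℂ) * E θ‖ = |r| := fun r θ => by
    have := Complex.norm_polarCoord_symm (r, θ)
    rwa [Complex.polarCoord_symm_apply] at this
  have hEd : ∀ θ, HasDerivAt E (E θ * I) θ := fun θ => by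
    have h1 := (Real.hasDerivAt_cos θ).ofReal_comp
    have h2 := ((Real.hasDerivAt_sin θ).ofReal_comp).mul_const I
    refine (h1.add h2).congr_deriv ?_
    simp only [hE, ofReal_neg]
    have h3 := I_mul_I
    linear_combination -(Real.sin θ : ℂ) * h3
  let A : ℝ × ℝ → ℂ := fun p => fderiv ℝ G (p.1 * E p.2) (E p.2)
  let B : ℝ × ℝ → ℂ := fun p => fderiv ℝ G (p.1 * E p.2) (E p.2 * I)
  have hA : Continuous A := by
    apply Continuous.clm_apply <;> fun_prop
  have hB : Continuous B := by
    apply Continuous.clm_apply <;> fun_prop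
  have hint : ∀ F : ℝ × ℝ → ℂ, Continuous F →
      IntegrableOn F (Ioc 0 R ×ˢ Ioc (-Real.pi) Real.pi) := fun F hF =>
    (hF.continuousOn.integrableOn_compact (isCompact_Icc.prod isCompact_Icc)).mono_set
      (prod_mono Ioc_subset_Icc_self Ioc_subset_Icc_self)
  rw [← Complex.integral_comp_polarCoord_symm]
  have s1 : (∫ p in polarCoord.target, p.1 • ((Complex.polarCoord.symm p)⁻¹ *
      (fderiv ℝ G (Complex.polarCoord.symm p) 1 + I * fderiv ℝ G (Complex.polarCoord.symm p) I)))
      = ∫ p in Ioi (0 : ℝ) ×ˢ Ioo (-Real.pi) Real.pi, (A p + I * B p) := by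
    refine setIntegral_congr_fun (measurableSet_Ioi.prod measurableSet_Ioo) fun p hp => ?_
    have hr : (p.1 : ℂ) ≠ 0 := by
      have : (0 : ℝ) < p.1 := hp.1
      exact_mod_cast this.ne'
    have hE0 : E p.2 ≠ 0 := by
      intro h
      have := hEn 1 p.2
      simp [h] at this
    simp only [Complex.polarCoord_symm_apply, A, B]
    change p.1 • (((p.1 : ℂ) * E p.2)⁻¹ * (fderiv ℝ G (p.1 * E p.2) 1
      + I * fderiv ℝ G (p.1 * E p.2) I)) = _
    rw [clm_complex _ (E p.2), clm_complex _ (E p.2 * I)]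
    generalize fderiv ℝ G (p.1 * E p.2) 1 = a
    generalize fderiv ℝ G (p.1 * E p.2) I = b
    have hre : (E p.2).re = Real.cos p.2 := by simp [hE, -ofReal_cos, -ofReal_sin]
    have him : (E p.2).im = Real.sin p.2 := by simp [hE, -ofReal_cos, -ofReal_sin]
    have hre' : (E p.2 * I).re = -Real.sin p.2 := by simp [him]
    have him' : (E p.2 * I).im = Real.cos p.2 := by simp [hre]
    rw [hre, him, hre', him', real_smul]
    have hsc : (Real.sin p.2 : ℂ) ^ 2 + (Real.cos p.2 : ℂ) ^ 2 = 1 := by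
      exact_mod_cast Real.sin_sq_add_cos_sq p.2
    have h3 := I_mul_I
    field_simp
    simp only [hE, ofReal_neg]
    generalize (Real.sin p.2 : ℂ) = s at *
    generalize (Real.cos p.2 : ℂ) = c at *
    linear_combination (-a - I * b) * hsc + (a * s ^ 2 - b * s * c) * h3
  rw [s1]
  have s2 : ∫ p in Ioi (0 : ℝ) ×ˢ Ioo (-Real.pi) Real.pi, (A p + I * B p)
      = ∫ p in Ioc 0 R ×ˢ Ioo (-Real.pi) Real.pi, (A p + I * B p) := by
    refine setIntegral_eq_of_subset_of_forall_sdiff_eq_zero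
      (measurableSet_Ioi.prod measurableSet_Ioo) (Set.prod_mono Ioc_subset_Ioi_self subset_rfl) ?_
    rintro p ⟨⟨h1, h2⟩, h3⟩
    have h4 : R ≤ p.1 := by
      by_contra h
      exact h3 ⟨⟨h1, (not_le.1 h).le⟩, h2⟩
    have h5 := hG1 (p.1 * E p.2) (by rw [hEn]; exact h4.trans (le_abs_self _))
    simp [A, B, h5]
  have s3 : ∫ p in Ioc 0 R ×ˢ Ioo (-Real.pi) Real.pi, (A p + I * B p)
      = (∫ p in Ioc 0 R ×ˢ Ioo (-Real.pi) Real.pi, A p)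
        + I * ∫ p in Ioc 0 R ×ˢ Ioo (-Real.pi) Real.pi, B p := by
    rw [integral_add, integral_const_mul]
    · exact (hint A hA).mono_set (prod_mono subset_rfl Ioo_subset_Ioc_self)
    · exact ((hint B hB).mono_set (prod_mono subset_rfl Ioo_subset_Ioc_self)).const_mul I
  have hpi : -Real.pi ≤ Real.pi := by linarith [Real.pi_pos]
  have s4 : ∀ F : ℝ × ℝ → ℂ, Continuous F →
      ∫ p in Ioc 0 R ×ˢ Ioo (-Real.pi) Real.pi, F p =
      ∫ r in (0 : ℝ)..R, ∫ θ in (-Real.pi)..Real.pi, F (r, θ) := fun F hF => by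
    rw [Measure.volume_eq_prod, setIntegral_prod, intervalIntegral.integral_of_le hR.le]
    · simp_rw [intervalIntegral.integral_of_le hpi, integral_Ioc_eq_integral_Ioo]
    · exact (hint F hF).mono_set (prod_mono subset_rfl Ioo_subset_Ioc_self)
  rw [s2, s3, s4 A hA, s4 B hB]
  have sB : ∫ r in (0 : ℝ)..R, ∫ θ in (-Real.pi)..Real.pi, B (r, θ) = 0 := by
    rw [intervalIntegral.integral_of_le hR.le]
    refine setIntegral_eq_zero_of_forall_eq_zero fun r hr => ?_
    have h1 : ∫ θ in (-Real.pi)..Real.pi, (r : ℂ) * B (r, θ)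
        = G (r * E Real.pi) - G (r * E (-Real.pi)) := by
      refine intervalIntegral.integral_eq_sub_of_hasDerivAt (f := fun θ => G (r * E θ)) (fun θ _ => ?_) ?_
      · have := (hd (r * E θ)).comp_hasDerivAt θ ((hEd θ).const_mul (r : ℂ))
        refine this.congr_deriv ?_
        rw [← real_smul (z := E θ * I), map_smul, real_smul]
      · exact (continuous_const.mul (hB.comp (by fun_prop))).intervalIntegrable _ _
    rw [intervalIntegral.integral_const_mul] at h1
    have h2 : E Real.pi = E (-Real.pi) := by simp [hE]
    rw [h2, sub_self] at h1
    exact (mul_eq_zero.1 h1).resolve_left (by exact_mod_cast hr.1.ne')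
  have sA : ∫ r in (0 : ℝ)..R, ∫ θ in (-Real.pi)..Real.pi, A (r, θ) = -(2 * Real.pi * G 0) := by
    rw [intervalIntegral_intervalIntegral_swap (F := fun r θ => A (r, θ))]
    · have h1 : ∀ θ : ℝ, ∫ r in (0 : ℝ)..R, A (r, θ) = - G 0 := fun θ => by
        have : ∫ r in (0 : ℝ)..R, A (r, θ) = G (R * E θ) - G ((0 : ℝ) * E θ) := by
          refine intervalIntegral.integral_eq_sub_of_hasDerivAt (f := fun r : ℝ => G (r * E θ)) (fun r _ => ?_) ?_
          · have h := (hd (r * E θ)).comp_hasDerivAt r ((ofRealCLM.hasDerivAt (x := r)).mul_const (E θ))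
            refine h.congr_deriv ?_
            simp [A]
          · exact (hA.comp (by fun_prop)).intervalIntegrable _ _
        rw [this, hG0 _ (by rw [hEn]; exact le_abs_self R)]
        simp
      simp_rw [h1, intervalIntegral.integral_const]
      rw [real_smul]
      push_cast
      ring
    · rw [uIoc_of_le hR.le, uIoc_of_le hpi]
      exact hint _ hA
  rw [sA, sB]; simp

/-- The Cauchy transform. -/
noncomputable def cauchyT (ψ : ℂ → ℂ) (z : ℂ) : ℂ := ∫ t : ℂ, t⁻¹ * ψ (z - t)

lemma cauchyT_dbar {ψ : ℂ → ℂ} (h : ContDiff ℝ 1 ψ) (hc : HasCompactSupport ψ) (z : ℂ) :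
    DbarAt (cauchyT ψ) (2 * Real.pi * ψ z) z := by
  have h1 := hc.hasFDerivAt_convolution_right (ContinuousLinearMap.mul ℝ ℂ) locInt_inv h z
  refine ⟨_, h1, ?_⟩
  have hex : Integrable (fun t : ℂ => ((ContinuousLinearMap.mul ℝ ℂ).precompR ℂ) t⁻¹
      (fderiv ℝ ψ (z - t))) :=
    (hc.fderiv ℝ).convolutionExists_right _ locInt_inv (h.continuous_fderiv one_ne_zero) z
  rw [convolution_def, ContinuousLinearMap.integral_apply hex,
    ContinuousLinearMap.integral_apply hex, ← integral_const_mul, ← integral_add]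
  · have h2 := pompeiu (G := fun t => ψ (z - t)) (by fun_prop) 
      (hc.comp_homeomorph (Homeomorph.subLeft z))
    have h3 : ∀ t, fderiv ℝ (fun t => ψ (z - t)) t = - fderiv ℝ ψ (z - t) := fun t => by
      have := (h.differentiable one_ne_zero (z - t)).hasFDerivAt.comp t
        ((hasFDerivAt_id (𝕜 := ℝ) t).const_sub z)
      refine this.fderiv.trans ?_
      ext
      simp
    simp only [h3, sub_zero] at h2
    rw [← neg_inj, ← h2, ← integral_neg]
    congr 1
    ext t
    simp
    ring
  · exact hex.apply_continuousLinearMap _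
  · exact (hex.apply_continuousLinearMap _).const_mul _

lemma dbar_piece {X K : Set ℂ} (hX : IsOpen X) (hK : IsCompact K) {ψ : ℂ → ℂ}
    (h : ContDiff ℝ 1 ψ) (hc : HasCompactSupport ψ) {v : ℂ → ℂ} {c : ℝ}
    (hv : DifferentiableOn ℂ v X) (hc0 : 0 ≤ c) (hvK : ∀ z ∈ K, ‖v z‖ ≤ c)
    (hs : ∀ z ∈ tsupport ψ, z ∈ X ∧ c < ‖v z‖) {ε : ℝ} (hε : 0 < ε) :
    ∃ u : ℂ → ℂ, (∀ z ∈ X, DbarAt u (ψ z) z) ∧ ∀ z ∈ K, ‖u z‖ ≤ ε := by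
  obtain ⟨c', hcc', hc's⟩ : ∃ c', c < c' ∧ ∀ z ∈ tsupport ψ, c' ≤ ‖v z‖ := by
    rcases (tsupport ψ).eq_empty_or_nonempty with he | hne
    · exact ⟨c + 1, by linarith, by simp [he]⟩
    · obtain ⟨x, hx, hmin⟩ := hc.isCompact.exists_isMinOn hne
        (f := fun z => ‖v z‖) ((hv.continuousOn.mono fun z hz => (hs z hz).1).norm)
      exact ⟨‖v x‖, (hs x hx).2, fun z hz => hmin hz⟩
  have hc'0 : 0 < c' := lt_of_le_of_lt hc0 hcc'
  obtain ⟨B, hB⟩ : ∃ B : ℝ, ∀ z ∈ K, ∫ t : ℂ, ‖t⁻¹‖ * ‖ψ (z - t)‖ ≤ B := by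
    have h1 : Continuous ((fun t : ℂ => ‖t⁻¹‖) ⋆[ContinuousLinearMap.mul ℝ ℝ, volume]
        (fun t => ‖ψ t‖)) :=
      hc.norm.continuous_convolution_right _ locInt_inv_norm h.continuous.norm
    obtain ⟨B, hB⟩ := hK.exists_bound_of_continuousOn h1.continuousOn
    exact ⟨B, fun z hz => (le_abs_self _).trans (hB z hz)⟩
  have hB1 : 0 < |B| + 1 := by positivity
  obtain ⟨N, hN⟩ := exists_pow_lt_of_lt_one (div_pos hε hB1) ((div_lt_one hc'0).2 hcc')
  have hvne : ∀ z ∈ tsupport ψ, v z ≠ 0 := fun z hz => by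
    have := (hs z hz).2
    exact norm_pos_iff.1 (lt_of_le_of_lt hc0 this)
  set φ : ℂ → ℂ := fun z => ψ z * ((v z)⁻¹) ^ N with hφ
  have hφd : ContDiff ℝ 1 φ := by
    rw [contDiff_iff_contDiffAt]
    intro z
    by_cases hz : z ∈ tsupport ψ
    · have h1 : ContDiffAt ℝ 1 v z :=
        ((hv.contDiffOn hX).contDiffAt (hX.mem_nhds (hs z hz).1)).restrict_scalars ℝ
      exact h.contDiffAt.mul ((h1.inv (hvne z hz)).pow N)
    · have : φ =ᶠ[𝓝 z] fun _ => 0 := by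
        filter_upwards [notMem_tsupport_iff_eventuallyEq.1 hz] with w hw
        simp [hφ, hw]
      exact contDiffAt_const.congr_of_eventuallyEq this
  have hφc : HasCompactSupport φ := hc.mul_right
  have hpi : (2 * Real.pi : ℂ) ≠ 0 := by
    simp [Real.pi_ne_zero]
  refine ⟨fun z => ((2 * Real.pi : ℂ)⁻¹ * v z ^ N) * cauchyT φ z, fun z hz => ?_, fun z hz => ?_⟩
  · have h1 : DifferentiableAt ℂ (fun z => (2 * Real.pi : ℂ)⁻¹ * v z ^ N) z :=
      ((hv.differentiableAt (hX.mem_nhds hz)).pow N).const_mul _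
    have h2 := (cauchyT_dbar hφd hφc z).mul (DbarAt.of_differentiableAt h1)
    convert h2 using 1
    by_cases h0 : ψ z = 0
    · simp [hφ, h0]
    · have := hvne z (subset_tsupport _ h0)
      simp only [hφ, inv_pow]
      field_simp
      ring
  · have h1 : ‖cauchyT φ z‖ ≤ ∫ t : ℂ, (‖t⁻¹‖ * ‖ψ (z - t)‖) * (c'⁻¹) ^ N := by
      refine norm_integral_le_of_norm_le ?_ ?_
      · refine Integrable.mul_const ?_ _
        exact hc.norm.convolutionExists_right (ContinuousLinearMap.mul ℝ ℝ) locInt_inv_norm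
          h.continuous.norm z
      · filter_upwards with t
        simp only [hφ]
        rw [norm_mul, norm_mul, mul_assoc]
        by_cases h0 : ψ (z - t) = 0
        · simp [h0]
        · gcongr
          rw [norm_pow, norm_inv]
          gcongr
          exact hc's _ (subset_tsupport _ h0)
    rw [integral_mul_const] at h1
    have h2 : ‖cauchyT φ z‖ ≤ (|B| + 1) * (c'⁻¹) ^ N := by
      refine h1.trans ?_
      gcongr
      linarith [hB z hz, le_abs_self B]
    have h3 : ‖(2 * Real.pi : ℂ)⁻¹‖ ≤ 1 := by
      rw [norm_inv]
      apply inv_le_one_of_one_le₀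
      simp only [norm_mul, Complex.norm_ofNat, norm_real, Real.norm_eq_abs]
      rw [abs_of_pos Real.pi_pos]
      linarith [Real.pi_gt_three]
    rw [norm_mul, norm_mul, norm_pow]
    calc ‖(2 * Real.pi : ℂ)⁻¹‖ * ‖v z‖ ^ N * ‖cauchyT φ z‖
        ≤ 1 * c ^ N * ((|B| + 1) * (c'⁻¹) ^ N) := by
          gcongr
          exact hvK z hz
      _ = (c / c') ^ N * (|B| + 1) := by rw [div_eq_mul_inv, mul_pow]; ring
      _ ≤ ε / (|B| + 1) * (|B| + 1) := by gcongr
      _ = ε := by field_simp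

lemma dbar_step {X K : Set ℂ} (hX : IsOpen X) (hK : IsCompact K)
    (hconv : ∀ ζ ∈ X, ζ ∉ K → ∃ (v : ℂ → ℂ) (c : ℝ), DifferentiableOn ℂ v X ∧ 0 ≤ c ∧
      (∀ z ∈ K, ‖v z‖ ≤ c) ∧ c < ‖v ζ‖)
    {ψ : ℂ → ℂ} (h : ContDiff ℝ 1 ψ) (hc : HasCompactSupport ψ)
    (hs : ∀ z ∈ tsupport ψ, z ∈ X ∧ z ∉ K) {ε : ℝ} (hε : 0 < ε) :
    ∃ u : ℂ → ℂ, (∀ z ∈ X, DbarAt u (ψ z) z) ∧ ∀ z ∈ K, ‖u z‖ ≤ ε := by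
  have H : ∀ ζ : tsupport ψ, ∃ (v : ℂ → ℂ) (c : ℝ), DifferentiableOn ℂ v X ∧ 0 ≤ c ∧
      (∀ z ∈ K, ‖v z‖ ≤ c) ∧ c < ‖v ζ‖ := fun ζ => hconv ζ (hs ζ ζ.2).1 (hs ζ ζ.2).2
  choose v c hv hc0 hvK hcv using H
  let V : tsupport ψ → Set ℂ := fun ζ => X ∩ (fun z => ‖v ζ z‖) ⁻¹' Ioi (c ζ)
  have hVo : ∀ ζ, IsOpen (V ζ) := fun ζ =>
    (hv ζ).continuousOn.norm.isOpen_inter_preimage hX isOpen_Ioi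
  obtain ⟨t, ht⟩ := hc.isCompact.elim_finite_subcover V hVo
    (fun z hz => mem_iUnion.2 ⟨⟨z, hz⟩, (hs z hz).1, hcv ⟨z, hz⟩⟩)
  obtain ⟨ρ, hρ⟩ := SmoothPartitionOfUnity.exists_isSubordinate 𝓘(ℝ, ℂ) (isClosed_tsupport ψ)
    (fun i : t => V i) (fun i => hVo i) (by
      intro z hz
      obtain ⟨i, hi, hiz⟩ := mem_iUnion₂.1 (ht hz)
      exact mem_iUnion.2 ⟨⟨i, hi⟩, hiz⟩)
  have hρd : ∀ i, ContDiff ℝ 1 (fun z => ((ρ i z : ℝ) : ℂ)) := fun i =>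
    ofRealCLM.contDiff.comp ((contMDiff_iff_contDiff.1 (ρ i).contMDiff).of_le (by exact_mod_cast le_top))
  have key : ∀ i : t, ∃ u : ℂ → ℂ, (∀ z ∈ X, DbarAt u ((ρ i z : ℂ) * ψ z) z) ∧
      ∀ z ∈ K, ‖u z‖ ≤ ε / (Fintype.card t + 1) := fun i => by
    refine dbar_piece hX hK ((hρd i).mul h) hc.mul_left (hv i) (hc0 i) (hvK i) ?_ (by positivity)
    intro z hz
    refine hρ i ?_
    have h1 := closure_mono (Function.support_mul_subset_left (fun z => ((ρ i z : ℝ) : ℂ)) ψ) hz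
    refine closure_mono ?_ h1
    intro w hw
    simpa using hw
  choose u hu huK using key
  refine ⟨fun z => ∑ i, u i z, fun z hz => ?_, fun z hz => ?_⟩
  · have h1 := DbarAt.sum Finset.univ (fun i _ => hu i z hz)
    convert h1 using 1
    rw [← Finset.sum_mul]
    by_cases h0 : z ∈ tsupport ψ
    · have h2 := ρ.sum_eq_one h0
      rw [finsum_eq_sum_of_fintype] at h2
      rw [← ofReal_sum, h2]; simp
    · rw [image_eq_zero_of_notMem_tsupport h0, mul_zero]
  · refine (norm_sum_le _ _).trans ((Finset.sum_le_sum fun i _ => huK i z hz).trans ?_)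
    rw [Finset.sum_const, nsmul_eq_mul, Finset.card_univ, mul_div_assoc', div_le_iff₀ (by positivity)]
    nlinarith

/-- The compact exhaustion. -/
def exK (X : Set ℂ) (n : ℕ) : Set ℂ := {z | ‖z‖ ≤ n ∧ ∀ p ∉ X, 1 / ((n : ℝ) + 1) ≤ ‖z - p‖}

lemma exK_compact (X : Set ℂ) (n : ℕ) : IsCompact (exK X n) := by
  have : IsClosed (exK X n) := by
    have : exK X n = {z | ‖z‖ ≤ n} ∩ ⋂ p ∈ Xᶜ, {z | 1 / ((n : ℝ) + 1) ≤ ‖z - p‖} := by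
      ext z; simp [exK]
    rw [this]
    refine (isClosed_le continuous_norm continuous_const).inter (isClosed_biInter fun p _ => ?_)
    exact isClosed_le continuous_const (by fun_prop)
  refine (isCompact_closedBall (0 : ℂ) n).of_isClosed_subset this fun z hz => ?_
  simpa using hz.1

lemma exK_sub (X : Set ℂ) (n : ℕ) : exK X n ⊆ X := by
  intro z hz
  by_contra h
  have := hz.2 z h
  rw [sub_self, norm_zero] at this
  have h2 : 0 < 1 / ((n : ℝ) + 1) := by positivity
  linarith

lemma exK_interior (X : Set ℂ) (n : ℕ) : exK X n ⊆ interior (exK X (n + 1)) := by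
  intro z hz
  rw [mem_interior_iff_mem_nhds]
  have hpos : 0 < 1 / ((n : ℝ) + 1) - 1 / ((n : ℝ) + 1 + 1) := by
    rw [sub_pos]
    exact one_div_lt_one_div_of_lt (by positivity) (by linarith)
  have hle : 1 / ((n : ℝ) + 1) - 1 / ((n : ℝ) + 1 + 1) ≤ 1 := by
    have h1 : 1 / ((n : ℝ) + 1) ≤ 1 := by
      rw [div_le_one (by positivity)]
      linarith [Nat.cast_nonneg (α := ℝ) n]
    have h2 : 0 < 1 / ((n : ℝ) + 1 + 1) := by positivity
    linarith
  filter_upwards [Metric.ball_mem_nhds z hpos] with w hw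
  rw [mem_ball_iff_norm] at hw
  refine ⟨?_, fun p hp => ?_⟩
  · have := norm_add_le (w - z) z
    rw [sub_add_cancel] at this
    push_cast
    linarith [hz.1]
  · have h1 := hz.2 p hp
    have h2 := norm_sub_le (w - p) (w - z)
    rw [sub_sub_sub_cancel_left] at h2
    push_cast
    linarith

lemma exK_mono (X : Set ℂ) : Monotone (exK X) :=
  monotone_nat_of_le_succ fun n => (exK_interior X n).trans interior_subset

lemma exK_exists {X : Set ℂ} (hX : IsOpen X) {z : ℂ} (hz : z ∈ X) : ∃ n, z ∈ exK X n := by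
  obtain ⟨δ, hδ, hb⟩ := Metric.isOpen_iff.1 hX z hz
  obtain ⟨n, hn⟩ := exists_nat_ge ‖z‖
  obtain ⟨m, hm⟩ := exists_nat_one_div_lt hδ
  refine ⟨max n m, ?_, fun p hp => ?_⟩
  · exact hn.trans (by exact_mod_cast le_max_left n m)
  · have h1 : 1 / (((max n m : ℕ) : ℝ) + 1) ≤ 1 / ((m : ℝ) + 1) := by
      apply one_div_le_one_div_of_le (by positivity)
      have : (m : ℝ) ≤ ((max n m : ℕ) : ℝ) := by exact_mod_cast le_max_right n m
      linarith
    by_contra h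
    apply hp
    apply hb
    rw [mem_ball_iff_norm, norm_sub_rev]
    linarith

lemma exK_conv (X : Set ℂ) (n : ℕ) : ∀ ζ ∈ X, ζ ∉ exK X n →
    ∃ (v : ℂ → ℂ) (c : ℝ), DifferentiableOn ℂ v X ∧ 0 ≤ c ∧
      (∀ z ∈ exK X n, ‖v z‖ ≤ c) ∧ c < ‖v ζ‖ := by
  intro ζ hζ hn
  by_cases h1 : ‖ζ‖ ≤ n
  · have : ∃ p ∉ X, ‖ζ - p‖ < 1 / ((n : ℝ) + 1) := by
      by_contra! h
      exact hn ⟨h1, h⟩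
    obtain ⟨p, hp, hlt⟩ := this
    refine ⟨fun z => (z - p)⁻¹, n + 1, ?_, by positivity, fun z hz => ?_, ?_⟩
    · intro z hz
      have : z - p ≠ 0 := sub_ne_zero.2 fun h => hp (h ▸ hz)
      exact ((differentiableAt_id.sub_const p).inv this).differentiableWithinAt
    · rw [norm_inv]
      apply inv_le_of_inv_le₀ (by positivity)
      simpa using hz.2 p hp
    · rw [norm_inv]
      have : 0 < ‖ζ - p‖ := norm_pos_iff.2 (sub_ne_zero.2 fun h => hp (h ▸ hζ))
      apply lt_inv_of_lt_inv₀ this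
      simpa using hlt
  · exact ⟨id, n, differentiableOn_id, by positivity, fun z hz => hz.1, not_le.1 h1⟩

/-- Solvability of the inhomogeneous Cauchy-Riemann equation on an arbitrary open set. -/
theorem dbar_solve {X : Set ℂ} (hX : IsOpen X) {ψ : ℂ → ℂ}
    (hψ : ∀ z ∈ X, ContDiffAt ℝ 1 ψ z) : ∃ u : ℂ → ℂ, ∀ z ∈ X, DbarAt u (ψ z) z := by
  have H : ∀ n : ℕ, ∃ θ : ℂ → ℂ, ContDiff ℝ 1 θ ∧ (∀ᶠ x in 𝓝ˢ (exK X n), θ x = 1) ∧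
      ∀ x ∉ exK X (n + 1), θ x = 0 := fun n => by
    obtain ⟨f, h1, h2, -⟩ := exists_contMDiffMap_one_nhds_of_subset_interior 𝓘(ℝ, ℂ)
      (n := 1) (exK_compact X n).isClosed (exK_interior X n)
    refine ⟨fun z => ((f z : ℝ) : ℂ),
      ofRealCLM.contDiff.comp (contMDiff_iff_contDiff.1 f.contMDiff), ?_, fun x hx => ?_⟩
    · filter_upwards [h1] with x hx
      simp [hx]
    · simp [h2 x hx]
  choose θ hθd hθ1 hθ0 using H
  have hts : ∀ (χ : ℂ → ℂ) (n : ℕ), (∀ x ∉ exK X n, χ x = 0) →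
      tsupport (fun z => χ z * ψ z) ⊆ exK X n := fun χ n h0 => by
    refine closure_minimal (fun z hz => ?_) (exK_compact X n).isClosed
    by_contra h
    exact hz (by simp [h0 z h])
  have hcs : ∀ (χ : ℂ → ℂ) (n : ℕ), (∀ x ∉ exK X n, χ x = 0) →
      HasCompactSupport (fun z => χ z * ψ z) := fun χ n h0 =>
    (exK_compact X n).of_isClosed_subset (isClosed_tsupport _) (hts χ n h0)
  have hcd : ∀ (χ : ℂ → ℂ) (n : ℕ), ContDiff ℝ 1 χ → (∀ x ∉ exK X n, χ x = 0) →
      ContDiff ℝ 1 (fun z => χ z * ψ z) := fun χ n hχ h0 => by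
    rw [contDiff_iff_contDiffAt]
    intro z
    by_cases hz : z ∈ tsupport (fun z => χ z * ψ z)
    · exact hχ.contDiffAt.mul (hψ z (exK_sub X n (hts χ n h0 hz)))
    · exact contDiffAt_const.congr_of_eventuallyEq (notMem_tsupport_iff_eventuallyEq.1 hz)
  have h00 : ∀ n x, x ∉ exK X (n + 2) → θ (n + 1) x - θ n x = 0 := fun n x hx => by
    rw [hθ0 (n + 1) x hx, hθ0 n x (fun h => hx (exK_mono X (by omega) h)), sub_self]
  -- the first piece
  obtain ⟨u0, hu0, -⟩ := dbar_step hX isCompact_empty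
    (fun ζ _ _ => ⟨fun _ => 1, 0, differentiableOn_const _, le_rfl, by simp, by simp⟩)
    (hcd (θ 0) 1 (hθd 0) (hθ0 0)) (hcs (θ 0) 1 (hθ0 0))
    (fun z hz => ⟨exK_sub X _ (hts (θ 0) 1 (hθ0 0) hz), by simp⟩) one_pos
  have key : ∀ n : ℕ, ∃ u : ℂ → ℂ,
      (∀ z ∈ X, DbarAt u ((θ (n + 1) z - θ n z) * ψ z) z) ∧
      ∀ z ∈ exK X n, ‖u z‖ ≤ (1 / 2 : ℝ) ^ n := fun n => by
    refine dbar_step hX (exK_compact X n) (exK_conv X n)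
      (hcd (fun z => θ (n + 1) z - θ n z) (n + 2) ((hθd _).sub (hθd _)) (h00 n))
      (hcs (fun z => θ (n + 1) z - θ n z) (n + 2) (h00 n)) (fun z hz => ⟨?_, fun hzK => ?_⟩)
      (by positivity)
    · exact exK_sub X _ (hts (fun z => θ (n + 1) z - θ n z) (n + 2) (h00 n) hz)
    · refine notMem_tsupport_iff_eventuallyEq.2 ?_ hz
      have h1 := eventually_nhdsSet_iff_forall.1 (hθ1 n) z hzK
      have h2 := eventually_nhdsSet_iff_forall.1 (hθ1 (n + 1)) z (exK_mono X (by omega) hzK)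
      filter_upwards [h1, h2] with w hw1 hw2
      simp [hw1, hw2]
  choose u hu huK using key
  refine ⟨fun z => u0 z + ∑' n, u n z, fun z hz => ?_⟩
  obtain ⟨m, hm⟩ := exK_exists hX hz
  have hm1 : z ∈ interior (exK X (m + 1)) := exK_interior X m hm
  have hsum : ∀ w ∈ exK X (m + 1), Summable fun n => u (n + (m + 1)) w := fun w hw => by
    refine Summable.of_norm_bounded (g := fun n => (1 / 2 : ℝ) ^ (n + (m + 1)))
      ((summable_nat_add_iff (m + 1)).2 summable_geometric_two) fun n => ?_
    exact huK _ w (exK_mono X (by omega) hw)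
  have htail : DifferentiableOn ℂ (fun w => ∑' n, u (n + (m + 1)) w) (interior (exK X (m + 1))) := by
    refine Complex.differentiableOn_tsum_of_summable_norm (u := fun n => (1 / 2 : ℝ) ^ (n + (m + 1)))
      ((summable_nat_add_iff (m + 1)).2 summable_geometric_two) (fun n w hw => ?_)
      isOpen_interior (fun n w hw => ?_)
    · have hwK := interior_subset hw
      have h1 := hu (n + (m + 1)) w (exK_sub X _ hwK)
      rw [(hθ1 (n + (m + 1))).self_of_nhdsSet w (exK_mono X (by omega) hwK),
        (hθ1 (n + (m + 1) + 1)).self_of_nhdsSet w (exK_mono X (by omega) hwK), sub_self,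
        zero_mul] at h1
      exact h1.differentiableAt.differentiableWithinAt
    · exact huK _ w (exK_mono X (by omega) (interior_subset hw))
  have h1 := (hu0 z hz).add ((DbarAt.sum (Finset.range (m + 1)) (fun n _ => hu n z hz)).add
    (DbarAt.of_differentiableAt (htail.differentiableAt (isOpen_interior.mem_nhds hm1))))
  have h2 : θ 0 z * ψ z + (∑ n ∈ Finset.range (m + 1), (θ (n + 1) z - θ n z) * ψ z + 0) = ψ z := by
    rw [← Finset.sum_mul, Finset.sum_range_sub (fun n => θ n z),
      (hθ1 (m + 1)).self_of_nhdsSet z (interior_subset hm1)]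
    ring
  rw [h2] at h1
  refine h1.congr ?_
  filter_upwards [isOpen_interior.mem_nhds hm1] with w hw
  have h3 := hsum w (interior_subset hw)
  rw [((summable_nat_add_iff (f := fun n => u n w) (m + 1)).1 h3).sum_add_tsum_nat_add (m + 1)]

/-- Surjectivity half of the independence of hyperfunctions on the complex neighborhood
(solved by a Cousin/Mittag-Leffler problem): if `X₁ ⊆ X₂` are open in `ℂ` with
`X₁ ∩ ℝ = X₂ ∩ ℝ = M`, then every `g` holomorphic on `X₁ ∖ M` can be written as
`g = f + h` on `X₁ ∖ M` with `f` holomorphic on `X₂ ∖ M` and `h` holomorphic on `X₁`. -/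
theorem hyperfunction_restriction_surjective
    (X₁ X₂ : Set ℂ) (M : Set ℂ) (hX₁ : IsOpen X₁) (hX₂ : IsOpen X₂) (h₁₂ : X₁ ⊆ X₂)
    (hM₁ : X₁ ∩ realAxis = M) (hM₂ : X₂ ∩ realAxis = M)
    (g : ℂ → ℂ) (hg : DifferentiableOn ℂ g (X₁ \ M)) :
    ∃ f h : ℂ → ℂ, DifferentiableOn ℂ f (X₂ \ M) ∧ DifferentiableOn ℂ h X₁ ∧
      ∀ z ∈ X₁ \ M, g z = f z + h z := by
  -- `X₁ \ M` and `X₂ \ M` are open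
  have hre : IsClosed realAxis := isClosed_eq continuous_im continuous_const
  have hX₁M : X₁ \ M = X₁ \ realAxis := by rw [← hM₁, Set.sdiff_self_inter]
  have hX₂M : X₂ \ M = X₂ \ realAxis := by rw [← hM₂, Set.sdiff_self_inter]
  have ho₁ : IsOpen (X₁ \ M) := hX₁M ▸ hX₁.sdiff hre
  have ho₂ : IsOpen (X₂ \ M) := hX₂M ▸ hX₂.sdiff hre
  have hMX₁ : M ⊆ X₁ := hM₁ ▸ inter_subset_left
  have hMre : M ⊆ realAxis := hM₁ ▸ inter_subset_right
  -- the cutoff function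
  obtain ⟨A, hAs, hAd, hAr⟩ := hX₁.exists_contDiff_support_eq (n := 2)
  have hA0 : ∀ z, 0 ≤ A z := fun z => (hAr ⟨z, rfl⟩).1
  have hden : ∀ z ∈ X₂, 0 < A z + z.im ^ 2 := fun z hz => by
    by_cases h : z.im = 0
    · have : z ∈ Function.support A := by
        rw [hAs]
        exact hMX₁ (hM₂ ▸ ⟨hz, h⟩)
      have h1 := (hA0 z).lt_of_ne (Ne.symm this)
      positivity
    · have := hA0 z
      positivity
  set q : ℂ → ℝ := fun z => A z / (A z + z.im ^ 2) with hq
  have hqd : ∀ z ∈ X₂, ContDiffAt ℝ 2 q z := fun z hz => by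
    have h1 : ContDiffAt ℝ 2 A z := hAd.contDiffAt
    have h2 : ContDiffAt ℝ 2 (fun z : ℂ => z.im ^ 2) z :=
      (imCLM.contDiff.contDiffAt).pow 2
    exact h1.div (h1.add h2) (hden z hz).ne'
  set φ : ℂ → ℂ := fun z => ((Real.smoothTransition (3 * q z - 1) : ℝ) : ℂ) with hφ
  have hφd : ∀ z ∈ X₂, ContDiffAt ℝ 2 φ z := fun z hz => by
    refine ofRealCLM.contDiff.contDiffAt.comp z ?_
    refine (Real.smoothTransition.contDiffAt (n := 2)).comp z ?_
    exact (contDiffAt_const.mul (hqd z hz)).sub contDiffAt_const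
  have hφ1 : ∀ z ∈ M, ∀ᶠ w in 𝓝 z, φ w = 1 := fun z hz => by
    have hz2 := h₁₂ (hMX₁ hz)
    have hqz : q z = 1 := by
      have : z.im = 0 := hMre hz
      have h2 := hden z hz2
      simp only [hq, this] at h2 ⊢
      simp at h2 ⊢
      exact h2.ne'
    have := (hqd z hz2).continuousAt.eventually_const_lt (u := 2 / 3) (by rw [hqz]; norm_num)
    filter_upwards [this] with w hw
    simp only [hφ]
    rw [Real.smoothTransition.one_of_one_le (by linarith)]
    simp
  have hφ0 : ∀ z ∈ X₂, z ∉ X₁ → ∀ᶠ w in 𝓝 z, φ w = 0 := fun z hz hz1 => by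
    have hqz : q z = 0 := by
      have : A z = 0 := by
        rw [← Function.notMem_support, hAs]
        exact hz1
      simp [hq, this]
    have := (hqd z hz).continuousAt.eventually_lt_const (u := 1 / 3) (by rw [hqz]; norm_num)
    filter_upwards [this] with w hw
    simp only [hφ]
    rw [Real.smoothTransition.zero_of_nonpos (by linarith)]
    simp
  -- the right-hand side
  set D : ℂ → ℂ := fun z => fderiv ℝ φ z 1 + I * fderiv ℝ φ z I with hD
  have hDd : ∀ z ∈ X₂, ContDiffAt ℝ 1 D z := fun z hz => by
    have h1 : ContDiffAt ℝ 1 (fderiv ℝ φ) z := (hφd z hz).fderiv_right (by norm_num)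
    exact (h1.clm_apply contDiffAt_const).add
      (contDiffAt_const.mul (h1.clm_apply contDiffAt_const))
  have hDc : ∀ (z c : ℂ), (∀ᶠ w in 𝓝 z, φ w = c) → ∀ᶠ w in 𝓝 z, D w = 0 := fun z c h => by
    filter_upwards [h.eventually_nhds] with w hw
    have : φ =ᶠ[𝓝 w] fun _ => c := hw
    simp [hD, this.fderiv_eq]
  have hφD : ∀ z ∈ X₂, DbarAt φ (D z) z := fun z hz =>
    ⟨fderiv ℝ φ z, ((hφd z hz).differentiableAt (by norm_num)).hasFDerivAt, rfl⟩
  have hψ : ∀ z ∈ X₂, ContDiffAt ℝ 1 (fun z => D z * g z) z := fun z hz => by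
    by_cases hzM : z ∈ M
    · have : (fun z => D z * g z) =ᶠ[𝓝 z] fun _ => 0 := by
        filter_upwards [hDc z 1 (hφ1 z hzM)] with w hw
        simp [hw]
      exact contDiffAt_const.congr_of_eventuallyEq this
    by_cases hz1 : z ∈ X₁
    · have : ContDiffAt ℝ 1 g z :=
        ((hg.contDiffOn ho₁).contDiffAt (ho₁.mem_nhds ⟨hz1, hzM⟩)).restrict_scalars ℝ
      exact (hDd z hz).mul this
    · have : (fun z => D z * g z) =ᶠ[𝓝 z] fun _ => 0 := by
        filter_upwards [hDc z 0 (hφ0 z hz hz1)] with w hw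
        simp [hw]
      exact contDiffAt_const.congr_of_eventuallyEq this
  obtain ⟨u, hu⟩ := dbar_solve hX₂ hψ
  have hnegu : ∀ z ∈ X₂, DbarAt (fun w => (-1) * u w) (-1 * (D z * g z) + 0 * u z) z :=
    fun z hz => (hu z hz).mul (DbarAt.of_differentiableAt (differentiableAt_const (-1)))
  have hf : DifferentiableOn ℂ (fun z => φ z * g z + (-1) * u z) (X₂ \ M) := by
    intro z hz
    refine (DbarAt.differentiableAt ?_).differentiableWithinAt
    by_cases hz1 : z ∈ X₁
    · have h1 := (DbarAt.of_differentiableAt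
        (hg.differentiableAt (ho₁.mem_nhds ⟨hz1, hz.2⟩))).mul (hφD z hz.1)
      convert h1.add (hnegu z hz.1) using 1
      ring
    · have h1 : DbarAt (fun w => φ w * g w) 0 z := by
        refine (DbarAt.of_differentiableAt (differentiableAt_const (0 : ℂ))).congr ?_
        filter_upwards [hφ0 z hz.1 hz1] with w hw
        simp [hw]
      convert h1.add (hnegu z hz.1) using 1
      rw [(hDc z 0 (hφ0 z hz.1 hz1)).self_of_nhds]
      ring
  refine ⟨_, fun z => (1 - φ z) * g z + u z, hf, fun z hz => ?_, fun z _ => by ring⟩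
  refine DifferentiableAt.differentiableWithinAt ?_
  by_cases hzM : z ∈ M
  · have h1 := hu z (h₁₂ hz)
    rw [(hDc z 1 (hφ1 z hzM)).self_of_nhds, zero_mul] at h1
    refine h1.differentiableAt.congr_of_eventuallyEq ?_
    filter_upwards [hφ1 z hzM] with w hw
    simp [hw]
  · have h1 := ho₁.mem_nhds ⟨hz, hzM⟩
    have h2 := hf.differentiableAt (ho₂.mem_nhds ⟨h₁₂ hz, hzM⟩)
    refine ((hg.differentiableAt h1).sub h2).congr_of_eventuallyEq ?_
    filter_upwards with w
    simp only [Pi.sub_apply]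
    ring
end

section
/- Let U ⊆ ℂ be an open connected set containing 0 and let f be holomorphic on U with z²·f′(z) + f(z) = 0 for all z ∈ U. Then f(z) = 0 for all z ∈ U. -/
open Set

/-- The holomorphic solution sheaf of `P = z²∂_z + 1` vanishes near `0`: if `U ⊆ ℂ` is open,
connected and contains `0`, every holomorphic `f` on `U` with `z²·f′(z) + f(z) = 0` vanishes. -/
theorem sol_of_irregular_operator_at_zero
    (U : Set ℂ) (hU : IsOpen U) (hUc : IsConnected U) (h0 : (0 : ℂ) ∈ U)
    (f : ℂ → ℂ) (hf : DifferentiableOn ℂ f U)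
    (hode : ∀ z ∈ U, z ^ 2 * deriv f z + f z = 0) :
    ∀ z ∈ U, f z = 0 := by
  have hfa : AnalyticOnNhd ℂ f U := hf.analyticOnNhd hU
  suffices h : ∀ᶠ z in nhds (0 : ℂ), f z = 0 from
    fun z hz => hfa.eqOn_zero_of_preconnected_of_eventuallyEq_zero hUc.isPreconnected h0 h hz
  by_contra hne
  obtain ⟨n, g, hg, hg0, hfg⟩ :=
    (hfa 0 h0).exists_eventuallyEq_pow_smul_nonzero_iff.mpr hne
  simp only [sub_zero, smul_eq_mul] at hfg
  apply hg0
  have hcont : ContinuousAt (fun z : ℂ => n * z * g z + z ^ 2 * deriv g z + g z) 0 := by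
    have h1 := hg.continuousAt
    have h2 := hg.deriv.continuousAt
    fun_prop
  have hev : ∀ᶠ z in nhdsWithin (0 : ℂ) {0}ᶜ,
      n * z * g z + z ^ 2 * deriv g z + g z = 0 := by
    filter_upwards [nhdsWithin_le_nhds hfg.eventually_nhds,
      nhdsWithin_le_nhds hg.eventually_analyticAt,
      nhdsWithin_le_nhds (hU.mem_nhds h0), self_mem_nhdsWithin] with z hz hgz hzU hz0
    have hz0' : z ≠ 0 := hz0
    have hd : deriv f z = n * z ^ (n - 1) * g z + z ^ n * deriv g z := by
      rw [Filter.EventuallyEq.deriv_eq hz]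
      exact ((hasDerivAt_pow n z).mul hgz.differentiableAt.hasDerivAt).deriv
    have ho := hode z hzU
    rw [hd, hz.self_of_nhds] at ho
    have hn : (n : ℂ) * z ^ (n - 1) * z = n * z ^ n := by
      cases n with
      | zero => simp
      | succ k => simp [pow_succ, mul_assoc]
    apply (mul_eq_zero.mp (_ : z ^ n * _ = 0)).resolve_left (pow_ne_zero n hz0')
    linear_combination ho - z * g z * hn
  have hlim := hcont.tendsto.mono_left (nhdsWithin_le_nhds (s := {0}ᶜ))
  have hlim0 : Filter.Tendsto (fun z : ℂ => n * z * g z + z ^ 2 * deriv g z + g z)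
      (nhdsWithin (0 : ℂ) {0}ᶜ) (nhds 0) :=
    tendsto_const_nhds.congr' (hev.mono fun z hz => hz.symm)
  simpa using tendsto_nhds_unique hlim hlim0
end

section
/- Let k be a field. Then the category Ind(Mod(k)) of ind-objects of the category of all k-vector spaces does not have enough injectives: it is not the case that every object admits a monomorphism into an injective object. -/
open CategoryTheory Limits Opposite
universe v u

section
variable {C : Type u} [Category.{v} C]

noncomputable def indHomIso (T : C) :
    coyoneda.obj (op ((Ind.yoneda (C := C)).obj T)) ≅
      Ind.inclusion C ⋙ (evaluation Cᵒᵖ (Type v)).obj (op T) :=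
  NatIso.ofComponents (fun Z => Equiv.toIso
    ((Ind.inclusion.fullyFaithful (C := C)).homEquiv.trans
      (((Ind.yonedaCompInclusion (C := C)).app T).homFromEquiv.trans yonedaEquiv)))
    (by
      intro Z Z' f
      ext g
      simp [Functor.FullyFaithful.homEquiv, yonedaEquiv, Iso.homFromEquiv])

variable {J : Type v} [SmallCategory J] [IsFiltered J] (G : J ⥤ C)

noncomputable def indHomIsColimit (T : C) :
    IsColimit ((coyoneda.obj (op ((Ind.yoneda (C := C)).obj T))).mapCocone
      (colimit.cocone (G ⋙ Ind.yoneda))) :=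
  haveI : PreservesColimitsOfShape J (coyoneda.obj (op ((Ind.yoneda (C := C)).obj T))) :=
    preservesColimitsOfShape_of_natIso (indHomIso T).symm
  isColimitOfPreserves _ (colimit.isColimit _)

lemma ind_factor (T : C) (f : Ind.yoneda.obj T ⟶ colimit (G ⋙ Ind.yoneda)) :
    ∃ (j : J) (g : T ⟶ G.obj j), Ind.yoneda.map g ≫ colimit.ι (G ⋙ Ind.yoneda) j = f := by
  obtain ⟨j, g, hg⟩ := Types.jointly_surjective_of_isColimit (indHomIsColimit G T) f
  refine ⟨j, Ind.yoneda.preimage g, ?_⟩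
  simpa using hg

lemma ind_eq (T : C) (i : J) (f g : T ⟶ G.obj i)
    (h : Ind.yoneda.map f ≫ colimit.ι (G ⋙ Ind.yoneda) i =
      Ind.yoneda.map g ≫ colimit.ι (G ⋙ Ind.yoneda) i) :
    ∃ (j : J) (u : i ⟶ j), f ≫ G.map u = g ≫ G.map u := by
  obtain ⟨j, u, hu⟩ := (Types.FilteredColimit.isColimit_eq_iff' (indHomIsColimit G T)
    (i := i) (Ind.yoneda.map f) (Ind.yoneda.map g)).1 (by simpa using h)
  refine ⟨j, u, Ind.yoneda.map_injective ?_⟩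
  simpa using hu

lemma ind_ι {i j : J} (u : i ⟶ j) :
    Ind.yoneda.map (G.map u) ≫ colimit.ι (G ⋙ Ind.yoneda) j = colimit.ι (G ⋙ Ind.yoneda) i :=
  colimit.w (G ⋙ Ind.yoneda) u
end

section
variable {k : Type} [Field k]

/-- Functor from a monotone family of submodules. -/
noncomputable def subFunctor {P : Type v} [Preorder P] {W : Type v} [AddCommGroup W] [Module k W]
    (D : P → Submodule k W) (hD : Monotone D) : P ⥤ ModuleCat.{v} k where
  obj p := ModuleCat.of k (D p)
  map f := ModuleCat.ofHom (Submodule.inclusion (hD (leOfHom f)))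

noncomputable def subIncl {P : Type v} [Preorder P] {W : Type v} [AddCommGroup W] [Module k W]
    (D : P → Submodule k W) (hD : Monotone D) :
    subFunctor D hD ⟶ (Functor.const P).obj (ModuleCat.of k W) where
  app p := ModuleCat.ofHom (D p).subtype

instance {P : Type v} [Preorder P] {W : Type v} [AddCommGroup W] [Module k W]
    (D : P → Submodule k W) (hD : Monotone D) : Mono (subIncl D hD) := by
  have : ∀ p, Mono ((subIncl D hD).app p) := fun p => by
    rw [ModuleCat.mono_iff_injective]
    exact Subtype.val_injective
  exact NatTrans.mono_of_mono_app _

/-- Extension of a compatible family to an injective object. -/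
lemma extend_family {P : Type v} [Preorder P] [IsDirectedOrder P] [OrderBot P]
    {W : Type v} [AddCommGroup W] [Module k W]
    (D : P → Submodule k W) (hD : Monotone D) (Z : Ind (ModuleCat.{v} k)) [Injective Z]
    (c : ∀ p, Ind.yoneda.obj (ModuleCat.of k (D p)) ⟶ Z)
    (hc : ∀ p q (h : p ≤ q),
      Ind.yoneda.map (ModuleCat.ofHom (Submodule.inclusion (hD h))) ≫ c q = c p) :
    ∃ h : Ind.yoneda.obj (ModuleCat.of k W) ⟶ Z,
      ∀ p, Ind.yoneda.map (ModuleCat.ofHom (D p).subtype) ≫ h = c p := by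
  let cc : Cocone (subFunctor D hD ⋙ Ind.yoneda) :=
    { pt := Z
      ι := { app := c
             naturality := fun p q f =>
              (hc p q (leOfHom f)).trans (Category.comp_id _).symm } }
  let F := (Functor.const P).obj (ModuleCat.of k W) ⋙ Ind.yoneda
  let m : colimit (subFunctor D hD ⋙ Ind.yoneda) ⟶ colimit F := (Ind.lim P).map (subIncl D hD)
  have i0 : HasLimitsOfShape WalkingCospan (ModuleCat.{v} k) :=
    have : HasLimits (ModuleCat.{v} k) := ModuleCat.hasLimitsOfSize.{v, v, v}
    have : HasFiniteLimits (ModuleCat.{v} k) := hasFiniteLimits_of_hasLimits _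
    inferInstance
  have i1 : PreservesLimitsOfShape WalkingCospan (Ind.lim P : (P ⥤ ModuleCat.{v} k) ⥤ _) :=
    inferInstance
  have : Mono m := (Ind.lim P).map_mono (subIncl D hD)
  let d : colimit (subFunctor D hD ⋙ Ind.yoneda) ⟶ Z := colimit.desc _ cc
  let h := Injective.factorThru d m
  have hh : m ≫ h = d := Injective.comp_factorThru d m
  refine ⟨colimit.ι F ⊥ ≫ h, fun p => ?_⟩
  have h1 : colimit.ι F ⊥ = colimit.ι F p := by
    have := colimit.w F (homOfLE (bot_le : ⊥ ≤ p))
    rw [← this]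
    simp [F]
  have h2 : colimit.ι (subFunctor D hD ⋙ Ind.yoneda) p ≫ m =
      Ind.yoneda.map (ModuleCat.ofHom (D p).subtype) ≫ colimit.ι F p := by
    simp only [m, Ind.lim]
    exact ι_colimMap _ _
  have h3 : colimit.ι (subFunctor D hD ⋙ Ind.yoneda) p ≫ d = c p := colimit.ι_desc _ _
  rw [h1, ← h3, ← hh, ← Category.assoc (colimit.ι _ _), h2]
  exact (Category.assoc _ _ _).symm


/-- Key lemma: a morphism from a vector space to an injective ind-object, vanishing
(in the ind-sense) on all finite subsets, is zero. -/
lemma key {J : Type v} [SmallCategory J] [IsFiltered J] (G : J ⥤ ModuleCat.{v} k)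
    [Injective (colimit (G ⋙ Ind.yoneda))]
    (X : ModuleCat.{v} k) (φ : Ind.yoneda.obj X ⟶ colimit (G ⋙ Ind.yoneda))
    (H : ∀ s : Finset X, ∃ (j : J) (g : X ⟶ G.obj j),
      Ind.yoneda.map g ≫ colimit.ι (G ⋙ Ind.yoneda) j = φ ∧ ∀ x ∈ s, g x = 0) :
    ∃ j, Ind.yoneda.map (0 : X ⟶ G.obj j) ≫ colimit.ι (G ⋙ Ind.yoneda) j = φ := by
  classical
  let A := Σ i j : J, (i ⟶ j)
  let B := A → X
  let P := Finset B × (B → Finset X)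
  let D : P → Submodule k (B →₀ X) := fun p =>
    { carrier := {f | ∀ b ∉ p.1, f b ∈ Submodule.span k (p.2 b : Set X)}
      add_mem' := fun {f g} hf hg b hb => Submodule.add_mem _ (hf b hb) (hg b hb)
      zero_mem' := fun b _ => Submodule.zero_mem _
      smul_mem' := fun c f hf b hb => Submodule.smul_mem _ c (hf b hb) }
  have memD : ∀ p f, f ∈ D p ↔ ∀ b ∉ p.1, f b ∈ Submodule.span k (p.2 b : Set X) :=
    fun _ _ => Iff.rfl
  have hD : Monotone D := fun p q h f hf b hb =>
    Submodule.span_mono (Finset.coe_subset.2 (h.2 b)) (hf b (fun hb' => hb (h.1 hb')))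
  let σ : ∀ p : P, (D p) →ₗ[k] X := fun p =>
    (∑ b ∈ p.1, Finsupp.lapply b) ∘ₗ (D p).subtype
  have σ_apply : ∀ p (f : D p), σ p f = ∑ b ∈ p.1, f.1 b := fun p f => by
    simp [σ]
  obtain ⟨h0, hh0⟩ := extend_family D hD (colimit (G ⋙ Ind.yoneda))
    (fun p => Ind.yoneda.map (ModuleCat.ofHom (σ p)) ≫ φ) (by
      intro p q hpq
      obtain ⟨j, g, rfl, hg⟩ := H ((q.1 \ p.1).biUnion p.2)
      simp only [← Functor.map_comp_assoc]
      congr 2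
      ext f
      have e1 : g (∑ b ∈ q.1, f.1 b) = g (∑ b ∈ p.1, f.1 b) := by
        rw [map_sum, map_sum]
        symm
        apply Finset.sum_subset hpq.1
        intro b hb hb'
        have h1 := (memD p f.1).1 f.2 b hb'
        have h2 : Submodule.span k (p.2 b : Set X) ≤ LinearMap.ker g.hom := by
          rw [Submodule.span_le]
          intro x hx
          exact hg x (Finset.mem_biUnion.2 ⟨b, Finset.mem_sdiff.2 ⟨hb, hb'⟩, hx⟩)
        exact h2 h1
      have e2 := σ_apply q (Submodule.inclusion (hD hpq) f)
      have e3 := σ_apply p f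
      change g (σ q (Submodule.inclusion (hD hpq) f)) = g (σ p f)
      rw [e2, e3]
      exact e1)
  -- representatives at a common index
  obtain ⟨j0, hh, φ', hhe, hφe⟩ : ∃ (j0 : J) (hh : ModuleCat.of k (B →₀ X) ⟶ G.obj j0)
      (φ' : X ⟶ G.obj j0), Ind.yoneda.map hh ≫ colimit.ι (G ⋙ Ind.yoneda) j0 = h0 ∧
        Ind.yoneda.map φ' ≫ colimit.ι (G ⋙ Ind.yoneda) j0 = φ := by
    obtain ⟨j1, a, ha⟩ := ind_factor G _ h0
    obtain ⟨j2, b, hb⟩ := ind_factor G _ φ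
    refine ⟨IsFiltered.max j1 j2, a ≫ G.map (IsFiltered.leftToMax _ _),
      b ≫ G.map (IsFiltered.rightToMax _ _), ?_, ?_⟩
    · rw [Functor.map_comp, Category.assoc, ind_ι, ha]
    · rw [Functor.map_comp, Category.assoc, ind_ι, hb]
  have single_eq : ∀ b : B, ∃ (j : J) (u : j0 ⟶ j),
      (ModuleCat.ofHom (Finsupp.lsingle b) ≫ hh) ≫ G.map u = φ' ≫ G.map u := by
    intro b
    apply ind_eq
    let p : P := ({b}, fun _ => ∅)
    let s : X →ₗ[k] D p := LinearMap.codRestrict (D p) (Finsupp.lsingle b) (by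
      intro x c hc
      have : c ≠ b := by simpa [p] using hc
      simp [this.symm])
    have hs : σ p ∘ₗ s = LinearMap.id := by
      ext x
      have := σ_apply p (s x)
      simpa [p, s] using this
    have e1 : ModuleCat.ofHom (Finsupp.lsingle b) =
        ModuleCat.ofHom s ≫ ModuleCat.ofHom (D p).subtype := rfl
    have e2 : ModuleCat.ofHom s ≫ ModuleCat.ofHom (σ p) = 𝟙 X := by
      rw [← ModuleCat.ofHom_comp, hs]; rfl
    rw [Functor.map_comp, Category.assoc, hhe, e1, Functor.map_comp, Category.assoc, hh0,
      ← Functor.map_comp_assoc, e2, hφe]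
    simp
  choose jj uu huu using single_eq
  obtain ⟨a, ha⟩ : ∃ a : A, ∀ x : X, ∃ b : B, (⟨j0, jj b, uu b⟩ : A) = a ∧ b a = x := by
    by_contra hcon
    push Not at hcon
    choose b hb using hcon
    exact hb _ b rfl rfl
  obtain ⟨b0, hb0, -⟩ := ha 0
  obtain ⟨i, j1, u1⟩ := a
  obtain rfl : j0 = i := congrArg Sigma.fst hb0
  have key1 : ∀ x : X, ∃ b : B, b ⟨j0, jj b, uu b⟩ = x ∧
      G.map u1 (hh (Finsupp.single b x)) = G.map u1 (φ' x) := by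
    intro x
    obtain ⟨b, hb, hbx⟩ := ha x
    refine ⟨b, by rw [hb, hbx], ?_⟩
    have := huu b
    obtain ⟨rfl, h2⟩ := Sigma.mk.inj_iff.1 (eq_of_heq (Sigma.mk.inj_iff.1 hb).2)
    obtain rfl := eq_of_heq h2
    exact congrArg (fun f => f.hom x) this
  let p : P := (∅, fun b => {b ⟨j0, jj b, uu b⟩})
  obtain ⟨j2, u2, hu2⟩ := ind_eq G (ModuleCat.of k (D p)) j0
    (ModuleCat.ofHom (D p).subtype ≫ hh) 0 (by
      have e : ModuleCat.ofHom (σ p) = 0 := by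
        ext f
        exact σ_apply p f
      rw [Functor.map_comp, Category.assoc, hhe, hh0, ← hφe, ← Functor.map_comp_assoc]
      rw [e]
      simp)
  obtain ⟨j3, v1, v2, hv⟩ := IsFiltered.span u1 u2
  have hz : φ' ≫ G.map (u1 ≫ v1) = 0 := by
    ext x
    obtain ⟨b, hb, hbx⟩ := key1 x
    have hm : Finsupp.single b x ∈ D p := by
      intro c _
      by_cases hcb : b = c
      · subst hcb
        rw [Finsupp.single_eq_same]
        exact Submodule.subset_span (by simp [p, hb])
      · rw [Finsupp.single_apply, if_neg hcb]
        exact Submodule.zero_mem _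
    have e1 : G.map u2 (hh (Finsupp.single b x)) = 0 := by
      rw [zero_comp] at hu2
      exact congrArg (fun f => f.hom ⟨_, hm⟩) hu2
    have e2 : G.map (u1 ≫ v1) (hh (Finsupp.single b x)) = 0 := by
      rw [hv, G.map_comp, ModuleCat.comp_apply, e1, map_zero]
    have e3 : G.map (u1 ≫ v1) (φ' x) = 0 := by
      rw [← e2, G.map_comp, ModuleCat.comp_apply, ModuleCat.comp_apply, hbx]
    exact e3
  refine ⟨j3, ?_⟩
  rw [← hz, Functor.map_comp, Category.assoc, ind_ι, hφe]

/-- The quotients of `X` by the spans of its finite subsets. -/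
noncomputable def quotFunctor (X : Type v) [AddCommGroup X] [Module k X] :
    Finset X ⥤ ModuleCat.{v} k where
  obj s := ModuleCat.of k (X ⧸ Submodule.span k (s : Set X))
  map f := ModuleCat.ofHom (Submodule.factor (Submodule.span_mono (Finset.coe_subset.2 (leOfHom f))))
  map_id s := by
    ext x
    rfl
  map_comp f g := by
    ext x
    rfl

end

/-- For a field `k`, the category `Ind(Mod k)` of ind-objects of the category of all
`k`-vector spaces does not have enough injectives. -/
theorem ind_moduleCat_not_enoughInjectives (k : Type) [Field k] :
    ¬ EnoughInjectives (Ind (ModuleCat k)) := by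
  classical
  intro hE
  let X := ULift.{_} (ℕ →₀ k)
  let XX := ModuleCat.of k X
  let Q := quotFunctor (k := k) X
  obtain ⟨⟨I, hI, m, hm⟩⟩ := hE.presentation (colimit (Q ⋙ Ind.yoneda))
  let G := I.presentation.F
  let e : colimit (G ⋙ Ind.yoneda) ≅ I := I.colimitPresentationCompYoneda
  have : Injective (colimit (G ⋙ Ind.yoneda)) := Injective.of_iso e.symm hI
  let m' := m ≫ e.inv
  let q : ∀ s : Finset X, XX ⟶ Q.obj s := fun s =>
    ModuleCat.ofHom (Submodule.mkQ (Submodule.span k (s : Set X)))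
  let π : Ind.yoneda.obj XX ⟶ colimit (Q ⋙ Ind.yoneda) :=
    Ind.yoneda.map (q ∅) ≫ colimit.ι (Q ⋙ Ind.yoneda) ∅
  have hq : ∀ {s t : Finset X} (h : s ⟶ t), q s ≫ Q.map h = q t := by
    intro s t h
    ext x
    rfl
  have hπ : ∀ s, Ind.yoneda.map (q s) ≫ colimit.ι (Q ⋙ Ind.yoneda) s = π := by
    intro s
    rw [← hq (homOfLE (Finset.empty_subset s)), Functor.map_comp, Category.assoc, ind_ι]
  obtain ⟨j, hj⟩ := key G XX (π ≫ m') (by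
    intro s
    obtain ⟨j, g, hg⟩ := ind_factor G (Q.obj s) (colimit.ι (Q ⋙ Ind.yoneda) s ≫ m')
    refine ⟨j, q s ≫ g, ?_, ?_⟩
    · rw [Functor.map_comp, Category.assoc, hg, ← Category.assoc, hπ]
    · intro x hx
      have : q s x = 0 :=
        (Submodule.Quotient.mk_eq_zero _).2 (Submodule.subset_span hx)
      rw [ModuleCat.comp_apply, this, map_zero])
  have h1 : Ind.yoneda.map (0 : XX ⟶ XX) ≫ π = π := by
    rw [← cancel_mono m', Category.assoc, ← hj, ← Functor.map_comp_assoc, zero_comp]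
  obtain ⟨s, u, hs⟩ := ind_eq Q XX ∅ (0 ≫ q ∅) (q ∅) (by
    rw [Functor.map_comp, Category.assoc]; exact h1)
  rw [hq, zero_comp, zero_comp] at hs
  have hspan : Submodule.span k (s : Set X) = ⊤ := by
    rw [eq_top_iff]
    intro x _
    have : q s x = 0 := (congrArg (fun f => f.hom x) hs).symm
    exact (Submodule.Quotient.mk_eq_zero _).1 this
  have hfin : Module.Finite k X := ⟨⟨s, hspan⟩⟩
  have : Module.Finite k (ℕ →₀ k) := Module.Finite.equiv ULift.moduleEquiv
  exact Module.Finite.not_linearIndependent_of_infinite _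
    (Finsupp.basisSingleOne (R := k) (ι := ℕ)).linearIndependent
end

section
/- Let C be an abelian category with enough injectives. Call an object A of Ind(C) quasi-injective if the functor Hom_{Ind(C)}(ι(−), A) : Cᵒᵖ → Ab is exact, equivalently if for every monomorphism u : X → Y in C the induced map Hom_{Ind(C)}(ι(Y), A) → Hom_{Ind(C)}(ι(X), A) is surjective. Then Ind(C) has enough quasi-injectives: every object of Ind(C) admits a monomorphism into a quasi-injective object. -/
open CategoryTheory Limits

universe v u

/-- An object `A` of `Ind C` is quasi-injective if the functor `Hom(ι(−), A)` is exact on `C`,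
i.e. for every monomorphism `u : X ⟶ Y` in `C` the induced map
`Hom(ι(Y), A) → Hom(ι(X), A)` is surjective. -/
def QuasiInjective {C : Type u} [Category.{v} C] (A : Ind C) : Prop :=
  ∀ ⦃X Y : C⦄ (u : X ⟶ Y), Mono u →
    Function.Surjective (fun g : (Ind.yoneda.obj Y ⟶ A) => Ind.yoneda.map u ≫ g)

open Opposite

section helpers
variable {C : Type u} [Category.{v} C]

/-- Morphisms from `X` to an ind-object are sections of the presheaf. -/
noncomputable def indEquiv (X : C) (A : Ind C) :
    (Ind.yoneda.obj X ⟶ A) ≃ ((Ind.inclusion C).obj A).obj (op X) :=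
  (Ind.inclusion.fullyFaithful.homEquiv).trans
    (((Ind.yonedaCompInclusion.app X).homFromEquiv).trans yonedaEquiv)

lemma indEquiv_comp (X : C) {A B : Ind C} (g : Ind.yoneda.obj X ⟶ A) (f : A ⟶ B) :
    indEquiv X B (g ≫ f) = ((Ind.inclusion C).map f).app (op X) (indEquiv X A g) := by
  simp [indEquiv, yonedaEquiv, Functor.FullyFaithful.homEquiv]

/-- Naturality of `indEquiv`, as an isomorphism of functors. -/
noncomputable def indEvalIso (X : C) : coyoneda.obj (op (Ind.yoneda.obj X)) ≅
    Ind.inclusion C ⋙ (evaluation _ _).obj (op X) :=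
  NatIso.ofComponents (fun A => (indEquiv X A).toIso) (by
    intro A B f
    ext g
    exact indEquiv_comp X g f)

instance (X : C) (J : Type v) [SmallCategory J] [IsFiltered J] :
    PreservesColimitsOfShape J (coyoneda.obj (op (Ind.yoneda.obj X))) :=
  preservesColimitsOfShape_of_natIso (indEvalIso X).symm

lemma ind_mono_of {A B : Ind C} (f : A ⟶ B)
    (h : ∀ (X : C) (x y : Ind.yoneda.obj X ⟶ A), x ≫ f = y ≫ f → x = y) : Mono f := by
  have : Mono ((Ind.inclusion C).map f) := by
    rw [NatTrans.mono_iff_mono_app]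
    intro X
    rw [mono_iff_injective]
    intro a b hab
    obtain ⟨x, rfl⟩ := (indEquiv X.unop A).surjective a
    obtain ⟨y, rfl⟩ := (indEquiv X.unop A).surjective b
    congr 1
    apply h
    apply (indEquiv _ _).injective
    rw [indEquiv_comp, indEquiv_comp]
    exact hab
  exact (Ind.inclusion C).mono_of_mono_map this

variable {J : Type v} [SmallCategory J] [IsFiltered J]

lemma ind_factor_s12 {F : J ⥤ Ind C} {c : Cocone F} (hc : IsColimit c) {X : C}
    (x : Ind.yoneda.obj X ⟶ c.pt) : ∃ (j : J) (y : Ind.yoneda.obj X ⟶ F.obj j),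
      y ≫ c.ι.app j = x :=
  Types.jointly_surjective_of_isColimit
    (isColimitOfPreserves (coyoneda.obj (op (Ind.yoneda.obj X))) hc) x

lemma ind_factor₂ {F : J ⥤ Ind C} {c : Cocone F} (hc : IsColimit c) {X : C}
    (x x' : Ind.yoneda.obj X ⟶ c.pt) : ∃ (j : J) (y y' : Ind.yoneda.obj X ⟶ F.obj j),
      y ≫ c.ι.app j = x ∧ y' ≫ c.ι.app j = x' :=
  Types.FilteredColimit.jointly_surjective_of_isColimit₂
    (isColimitOfPreserves (coyoneda.obj (op (Ind.yoneda.obj X))) hc) x x'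

lemma ind_eq_s12 {F : J ⥤ Ind C} {c : Cocone F} (hc : IsColimit c) {X : C} {j : J}
    (x x' : Ind.yoneda.obj X ⟶ F.obj j) (h : x ≫ c.ι.app j = x' ≫ c.ι.app j) :
    ∃ (k : J) (f : j ⟶ k), x ≫ F.map f = x' ≫ F.map f :=
  (Types.FilteredColimit.isColimit_eq_iff' 
    (isColimitOfPreserves (coyoneda.obj (op (Ind.yoneda.obj X))) hc) x x').1 h

/-- Pairs consisting of a finite subset of a partially ordered type and an upper bound of it. -/
structure PP (D : Type v) [PartialOrder D] : Type v where
  /-- the finite subset -/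
  fin : Finset D
  /-- the upper bound -/
  top : D
  le_top : ∀ s ∈ fin, s ≤ top

instance (D : Type v) [PartialOrder D] : Preorder (PP D) where
  le p q := p.fin ⊆ q.fin ∧ p.top ≤ q.top
  le_refl p := ⟨Finset.Subset.refl _, le_refl _⟩
  le_trans p q r h h' := ⟨h.1.trans h'.1, h.2.trans h'.2⟩

variable (D : Type v) [PartialOrder D]

/-- The upper bound, as a functor. -/
def PP.snd : PP D ⥤ D :=
  Monotone.functor (f := fun p => p.top) (fun _ _ h => h.2)

instance [IsDirectedOrder D] : IsDirectedOrder (PP D) := ⟨by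
  classical
  intro p q
  obtain ⟨d, h1, h2⟩ := exists_ge_ge p.top q.top
  refine ⟨⟨p.fin ∪ q.fin, d, ?_⟩, ⟨Finset.subset_union_left, h1⟩,
    ⟨Finset.subset_union_right, h2⟩⟩
  intro s hs
  rcases Finset.mem_union.1 hs with hs | hs
  · exact (p.le_top s hs).trans h1
  · exact (q.le_top s hs).trans h2⟩

instance [Nonempty D] : Nonempty (PP D) :=
  ⟨⟨∅, Classical.arbitrary D, by simp⟩⟩

instance [IsDirectedOrder D] [Nonempty D] : (PP.snd D).Final :=
  Functor.final_of_exists_of_isFiltered _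
    (fun d => ⟨⟨∅, d, by simp⟩, ⟨𝟙 d⟩⟩)
    (fun {d c} _ _ => ⟨c, 𝟙 c, Subsingleton.elim _ _⟩)

end helpers

section ab
variable {C : Type u} [Category.{v} C] [Abelian C] {D : Type v} [PartialOrder D]

/-- The functor sending `(S, i)` to the coproduct of the `E s` for `s ∈ S`. -/
noncomputable def KK (E : D → C) : PP D ⥤ C where
  obj p := ∐ fun s : p.fin => E s
  map {p q} h := Sigma.desc fun s : p.fin =>
    Sigma.ι (fun s : q.fin => E s) ⟨s.1, (leOfHom h).1 s.2⟩
  map_id p := by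
    apply Sigma.hom_ext
    intro s
    simp
  map_comp h h' := by
    apply Sigma.hom_ext
    intro s
    simp

/-- The inclusion of a summand. -/
noncomputable def KK.ι (E : D → C) (p : PP D) (s : D) (hs : s ∈ p.fin) : E s ⟶ (KK E).obj p :=
  Sigma.ι (fun s : p.fin => E s) ⟨s, hs⟩

lemma KK.ι_map (E : D → C) {p q : PP D} (h : p ⟶ q) (s : D) (hs : s ∈ p.fin) :
    KK.ι E p s hs ≫ (KK E).map h = KK.ι E q s ((leOfHom h).1 hs) := by
  simp [KK, KK.ι]

lemma KK.hom_ext (E : D → C) {p : PP D} {Z : C} {f g : (KK E).obj p ⟶ Z}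
    (h : ∀ s hs, KK.ι E p s hs ≫ f = KK.ι E p s hs ≫ g) : f = g :=
  Sigma.hom_ext _ _ (fun s => h s.1 s.2)

/-- Maps out of the coproduct. -/
noncomputable def KK.desc (E : D → C) {p : PP D} {Z : C} (f : ∀ s ∈ p.fin, E s ⟶ Z) :
    (KK E).obj p ⟶ Z := Sigma.desc fun s : p.fin => f s.1 s.2

lemma KK.ι_desc (E : D → C) {p : PP D} {Z : C} (f : ∀ s ∈ p.fin, E s ⟶ Z) (s : D)
    (hs : s ∈ p.fin) : KK.ι E p s hs ≫ KK.desc E f = f s hs :=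
  Sigma.ι_desc (fun s : p.fin => f s.1 s.2) ⟨s, hs⟩

/-- Functoriality of `KK`. -/
noncomputable def KK.mapE {E E' : D → C} (e : ∀ d, E d ⟶ E' d) : KK E ⟶ KK E' where
  app p := Limits.Sigma.map (fun s : p.fin => e s.1)
  naturality p q h := by
    apply Sigma.hom_ext
    intro s
    dsimp only [KK]
    rw [Sigma.ι_desc_assoc, Sigma.ι_map_assoc, Sigma.ι_map, Sigma.ι_desc]

lemma KK.ι_mapE {E E' : D → C} (e : ∀ d, E d ⟶ E' d) (p : PP D) (s : D) (hs : s ∈ p.fin) :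
    KK.ι E p s hs ≫ (KK.mapE e).app p = e s ≫ KK.ι E' p s hs :=
  Sigma.ι_map (fun s : p.fin => e s.1) ⟨s, hs⟩

instance {E E' : D → C} (e : ∀ d, E d ⟶ E' d) [∀ d, Mono (e d)] : Mono (KK.mapE e) := by
  rw [NatTrans.mono_iff_mono_app]
  intro p
  have := Abelian.hasFiniteBiproducts (C := C)
  exact Sigma.map_mono (fun s : p.fin => e s.1)

/-- The canonical map from the coproducts to the original diagram. -/
noncomputable def KtoF (F : D ⥤ C) : KK F.obj ⟶ PP.snd D ⋙ F where
  app p := KK.desc _ fun s hs => F.map (homOfLE (p.le_top s hs))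
  naturality p q h := by
    apply KK.hom_ext
    intro s hs
    rw [← Category.assoc, KK.ι_map, KK.ι_desc, ← Category.assoc, KK.ι_desc]
    exact F.map_comp _ _

lemma exists_G (F : D ⥤ C) (E : D → C) (e : ∀ d, F.obj d ⟶ E d) [∀ d, Mono (e d)] :
    ∃ (G : PP D ⥤ C) (φ : PP.snd D ⋙ F ⟶ G), (∀ p, Mono (φ.app p)) ∧
      ∀ d, ∃ (p : PP D) (hp : (PP.snd D).obj p = d) (r : E d ⟶ G.obj p), 
        F.map (eqToHom hp.symm) ≫ φ.app p = e d ≫ r := by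
  have hm : Mono (pushout.inl (KtoF F) (KK.mapE e)) := inferInstance
  refine ⟨pushout (KtoF F) (KK.mapE e), pushout.inl _ _,
    (NatTrans.mono_iff_mono_app _).1 hm, fun d => ?_⟩
  let p : PP D := ⟨{d}, d, by simp⟩
  have hd : d ∈ p.fin := Finset.mem_singleton_self d
  refine ⟨p, rfl, KK.ι E p d hd ≫ (pushout.inr (KtoF F) (KK.mapE e)).app p, ?_⟩
  have h := NatTrans.congr_app (pushout.condition (f := KtoF F) (g := KK.mapE e)) p
  rw [NatTrans.comp_app, NatTrans.comp_app] at h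
  have h1 : KK.ι F.obj p d hd ≫ (KtoF F).app p = F.map (eqToHom rfl) :=
    KK.ι_desc F.obj (fun s hs => F.map (homOfLE (p.le_top s hs))) d hd
  rw [← Category.assoc, ← KK.ι_mapE, Category.assoc, ← h, ← Category.assoc, h1]
  rfl

lemma ind_step [EnoughInjectives C] (A : Ind C) : ∃ (B : Ind C) (f : A ⟶ B), Mono f ∧
    ∀ ⦃X Y : C⦄ (u : X ⟶ Y), Mono u → ∀ g : Ind.yoneda.obj X ⟶ A,
      ∃ h : Ind.yoneda.obj Y ⟶ B, Ind.yoneda.map u ≫ h = g ≫ f := by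
  obtain ⟨D, _, _, _, T, _⟩ := IsFiltered.exists_directed A.presentation.I
  let c₀ : Cocone (A.presentation.F ⋙ Ind.yoneda) :=
    (colimit.cocone _).extend (A.colimitPresentationCompYoneda.hom)
  have hc₀ : IsColimit c₀ := (colimit.isColimit _).extendIso _
  let F : D ⥤ C := T ⋙ A.presentation.F
  let c : Cocone (F ⋙ Ind.yoneda) := c₀.whisker T
  have hc : IsColimit c := (Functor.Final.isColimitWhiskerEquiv T c₀).symm hc₀
  let c' : Cocone ((PP.snd D ⋙ F) ⋙ Ind.yoneda) := c.whisker (PP.snd D)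
  have hc' : IsColimit c' := (Functor.Final.isColimitWhiskerEquiv (PP.snd D) c).symm hc
  obtain ⟨G, φ, hφ, hG⟩ := exists_G F (fun d => Injective.under (F.obj d)) 
    (fun d => Injective.ι (F.obj d))
  let b := colimit.cocone (G ⋙ Ind.yoneda)
  have hb : IsColimit b := colimit.isColimit _
  let f : c'.pt ⟶ b.pt := hc'.map b (Functor.whiskerRight φ Ind.yoneda)
  have hf : ∀ p, c'.ι.app p ≫ f = Ind.yoneda.map (φ.app p) ≫ b.ι.app p := fun p =>
    hc'.ι_map b _ p
  refine ⟨b.pt, f, ?_, ?_⟩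
  · apply ind_mono_of
    intro X x y hxy
    obtain ⟨p, x, y, rfl, rfl⟩ := ind_factor₂ hc' x y
    simp only [Category.assoc, hf] at hxy
    simp only [← Category.assoc] at hxy
    obtain ⟨q, t, h⟩ := ind_eq_s12 hb _ _ hxy
    simp only [Category.assoc, Functor.comp_map, ← Functor.map_comp, ← φ.naturality] at h
    simp only [Functor.map_comp, ← Category.assoc] at h
    rw [cancel_mono] at h
    rw [← c'.w t]
    simp only [← Category.assoc]
    congr 1
  · intro X Y u _ g
    obtain ⟨d, x, hx⟩ := ind_factor_s12 hc g
    obtain ⟨x, rfl⟩ := Ind.yoneda.map_surjective x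
    obtain ⟨p, rfl, r, hr⟩ := hG d
    have hr' : φ.app p = Injective.ι _ ≫ r := by
      rw [← hr, eqToHom_refl, F.map_id]
      exact (Category.id_comp _).symm
    refine ⟨Ind.yoneda.map (Injective.factorThru (x ≫ Injective.ι _) u ≫ r) ≫ b.ι.app p, ?_⟩
    rw [← hx, Category.assoc]
    erw [hf p]
    rw [← Category.assoc, ← Category.assoc, ← Functor.map_comp, ← Functor.map_comp]
    rw [hr', ← Category.assoc, Injective.comp_factorThru, Category.assoc]


lemma ind_seq (S : ℕ → Ind C) (s : ∀ n, S n ⟶ S (n + 1)) (hf : ∀ n, Mono (s n))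
    (hB : ∀ n, ∀ ⦃X Y : C⦄ (u : X ⟶ Y), Mono u → ∀ g : Ind.yoneda.obj X ⟶ S n,
      ∃ h : Ind.yoneda.obj Y ⟶ S (n + 1), Ind.yoneda.map u ≫ h = g ≫ s n) :
    ∃ (I : Ind C) (f : S 0 ⟶ I), Mono f ∧ QuasiInjective I := by
  let e : ULift.{v} ℕ ⥤ ℕ := Monotone.functor (f := ULift.down) (fun _ _ h => h)
  let H : ULift.{v} ℕ ⥤ Ind C := e ⋙ Functor.ofSequence s
  let c := colimit.cocone H
  have hc : IsColimit c := colimit.isColimit _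
  have hs : ∀ n, (Functor.ofSequence s).map (homOfLE (Nat.le_add_right n 1)) = s n :=
    Functor.ofSequence_map_homOfLE_succ s
  have hm : ∀ (n k : ℕ), Mono ((Functor.ofSequence s).map (homOfLE (Nat.le_add_right n k))) := by
    intro n k
    induction k with
    | zero => exact inferInstanceAs (Mono ((Functor.ofSequence s).map (𝟙 n)))
    | succ k ih =>
      have : homOfLE (Nat.le_add_right n (k+1)) = 
        homOfLE (Nat.le_add_right n k) ≫ homOfLE (Nat.le_add_right (n+k) 1) := rfl
      rw [this, Functor.map_comp, hs]
      exact @mono_comp _ _ _ _ _ _ ih _ (hf (n + k))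
  have hm' : ∀ {i j : ℕ} (t : i ⟶ j), Mono ((Functor.ofSequence s).map t) := by
    intro i j t
    obtain ⟨k, rfl⟩ := Nat.exists_eq_add_of_le (leOfHom t)
    exact hm i k
  refine ⟨c.pt, c.ι.app ⟨0⟩, ?_, ?_⟩
  · apply ind_mono_of
    intro X x y hxy
    obtain ⟨k, t, h⟩ := ind_eq_s12 hc x y hxy
    have : Mono (H.map t) := hm' (e.map t)
    exact this.right_cancellation x y h
  · intro X Y u hu g
    obtain ⟨⟨n⟩, x, rfl⟩ := ind_factor_s12 hc g
    obtain ⟨y, hy⟩ := hB n u hu x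
    refine ⟨y ≫ c.ι.app ⟨n + 1⟩, ?_⟩
    let t : (⟨n⟩ : ULift.{v} ℕ) ⟶ ⟨n + 1⟩ :=
      homOfLE (show (⟨n⟩ : ULift.{v} ℕ) ≤ ⟨n + 1⟩ from Nat.le_add_right n 1)
    have hw := c.w t
    have hH : H.map t = s n := hs n
    have aux : ∀ (q : S (n + 1) ⟶ c.pt) (x : Ind.yoneda.obj X ⟶ S n),
        Ind.yoneda.map u ≫ y = x ≫ s n →
        Ind.yoneda.map u ≫ y ≫ q = x ≫ s n ≫ q := by
      intro q x hx
      rw [← Category.assoc, hx, Category.assoc]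
    rw [← hw, hH]
    exact aux (c.ι.app ⟨n + 1⟩) x hy

end ab

/-- If `C` is an abelian category with enough injectives, then `Ind C` has enough
quasi-injectives: every object admits a monomorphism into a quasi-injective object. -/
theorem ind_enough_quasiInjectives
    (C : Type u) [Category.{v} C] [Abelian C] [EnoughInjectives C] (A : Ind C) :
    ∃ (I : Ind C) (f : A ⟶ I), Mono f ∧ QuasiInjective I := by
  choose B f hf hB using ind_step (C := C)
  exact ind_seq (fun n => Nat.rec A (fun _ => B) n) (fun n => f _) (fun n => hf _)
    (fun n => hB _)
end
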